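/- arXiv:1512.02279 — 2 statements merged into one kernel-verified Lean document; each statement's English description precedes it below -/
import Mathlib

section
/- rank(M_0) = 1, and rank(M_n) = 2n for all n ≥ 1. -/
/-!
Partial Brauer diagrams on `n` points are formalized as set partitions
(equivalence relations, i.e. `Setoid`s) of the vertex set
`{1,…,n} ∪ {1',…,n'}`, encoded as `Fin n ⊕ Fin n`
(`Sum.inl i` is the upper vertex `i`, `Sum.inr i` is the lower vertex `i'`),
all of whose blocks have size at most 2.  The product of two diagrams is
defined via connectivity (paths) in the product graph, and the involution `*`
by interchanging the two rows of vertices.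
-/

noncomputable section

open scoped Classical

/-- Vertices of a diagram on `n` points. -/
abbrev PBV (n : ℕ) := Fin n ⊕ Fin n

/-- A "diagram candidate": an arbitrary set partition of the vertices. -/
abbrev Dgm (n : ℕ) := Setoid (PBV n)

/-- The equivalence relation ("joined by a path") generated by a relation. -/
inductive RGen {V : Type*} (r : V → V → Prop) : V → V → Prop
  | rel {x y : V} : r x y → RGen r x y
  | refl (x : V) : RGen r x x
  | symm {x y : V} : RGen r x y → RGen r y x
  | trans {x y z : V} : RGen r x y → RGen r y z → RGen r x z

namespace Dgm

variable {n : ℕ}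

/-- Vertices of the product graph: top, middle and bottom rows. -/
abbrev V3 (n : ℕ) := Fin n ⊕ (Fin n ⊕ Fin n)

/-- The first factor occupies the top and middle rows of the product graph. -/
def topMid : PBV n → V3 n
  | Sum.inl i => Sum.inl i
  | Sum.inr i => Sum.inr (Sum.inl i)

/-- The second factor occupies the middle and bottom rows of the product graph. -/
def midBot : PBV n → V3 n
  | Sum.inl i => Sum.inr (Sum.inl i)
  | Sum.inr i => Sum.inr (Sum.inr i)

/-- The product diagram occupies the top and bottom rows of the product graph. -/
def topBot : PBV n → V3 n
  | Sum.inl i => Sum.inl i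
  | Sum.inr i => Sum.inr (Sum.inr i)

/-- The edges of the product graph `Γ(α, β)`. -/
def prodEdges (α β : Dgm n) (x y : V3 n) : Prop :=
  (∃ a b : PBV n, α.r a b ∧ x = topMid a ∧ y = topMid b) ∨
  (∃ a b : PBV n, β.r a b ∧ x = midBot a ∧ y = midBot b)

/-- The product of two diagrams: two vertices lie in the same block of `α β`
iff they are joined by a path in the product graph `Γ(α, β)`. -/
def pmul (α β : Dgm n) : Dgm n where
  r x y := RGen (prodEdges α β) (topBot x) (topBot y)
  iseqv := ⟨fun _ => RGen.refl _, fun h => h.symm, fun h₁ h₂ => h₁.trans h₂⟩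

/-- Interchanging the upper and the lower vertices. -/
def swapUD : PBV n → PBV n
  | Sum.inl i => Sum.inr i
  | Sum.inr i => Sum.inl i

/-- The involution `α ↦ α*` (reflection in a horizontal axis). -/
def pstar (α : Dgm n) : Dgm n := Setoid.comap swapUD α

/-- All blocks of `α` have size at most 2. -/
def IsPB (α : Dgm n) : Prop :=
  ∀ x y z : PBV n, α.r x y → α.r x z → x = y ∨ x = z ∨ y = z

/-- The partial Brauer monoid `PB_n` (as a set of diagrams). -/
def PBset (n : ℕ) : Set (Dgm n) := {α | IsPB α}

/-- The position of a vertex in the linear order `1 < 2 < ⋯ < n < n' < ⋯ < 1'`. -/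
def vpos : PBV n → ℕ
  | Sum.inl i => (i : ℕ)
  | Sum.inr i => 2 * n - 1 - (i : ℕ)

/-- Planarity: no two blocks cross in the order `1 < ⋯ < n < n' < ⋯ < 1'`. -/
def IsPlanar (α : Dgm n) : Prop :=
  ∀ a b c d : PBV n, α.r a b → α.r c d →
    vpos a < vpos c → vpos c < vpos b → vpos b < vpos d → False

/-- The Motzkin monoid `M_n` (as a set of diagrams). -/
def Mset (n : ℕ) : Set (Dgm n) := {α | IsPB α ∧ IsPlanar α}

/-- The domain of `α`: upper points lying in a transversal block. -/
def domSet (α : Dgm n) : Set (Fin n) := {i | ∃ j, α.r (Sum.inl i) (Sum.inr j)}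

/-- The codomain of `α`: lower points lying in a transversal block. -/
def codomSet (α : Dgm n) : Set (Fin n) := {i | ∃ j, α.r (Sum.inr i) (Sum.inl j)}

/-- The rank of a diagram: the number of its transversal blocks (for a diagram
with blocks of size at most 2, each transversal block contains exactly one
upper point, so this is the size of the domain). -/
def prank (α : Dgm n) : ℕ := (domSet α).ncard

/-- `α` is an idempotent. -/
def IsIdpt (α : Dgm n) : Prop := pmul α α = α

/-- `α` is a projection. -/
def IsProj (α : Dgm n) : Prop := pmul α α = α ∧ pstar α = α

/-- The D-class `D_r(PB_n)`. -/
def DPB (n r : ℕ) : Set (Dgm n) := {α | α ∈ PBset n ∧ prank α = r}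

/-- The ideal `I_r(PB_n)`. -/
def IPB (n r : ℕ) : Set (Dgm n) := {α | α ∈ PBset n ∧ prank α ≤ r}

/-- The D-class `D_r(M_n)`. -/
def DM (n r : ℕ) : Set (Dgm n) := {α | α ∈ Mset n ∧ prank α = r}

/-- The ideal `I_r(M_n)`. -/
def IM (n r : ℕ) : Set (Dgm n) := {α | α ∈ Mset n ∧ prank α ≤ r}

end Dgm

/-- Membership in the closure of a subset under a binary operation. -/
inductive MClo {γ : Type*} (m : γ → γ → γ) (X : Set γ) : γ → Prop
  | base {x : γ} : x ∈ X → MClo m X x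
  | mul {x y : γ} : MClo m X x → MClo m X y → MClo m X (m x y)

/-- The subsemigroup `⟨X⟩` generated by the subset `X`. -/
def genSet {γ : Type*} (m : γ → γ → γ) (X : Set γ) : Set γ := {x | MClo m X x}

/-- The rank of `T`: the least size of a generating set. -/
noncomputable def rnk {γ : Type*} (m : γ → γ → γ) (T : Set γ) : ℕ :=
  sInf {k | ∃ X : Finset γ, X.card = k ∧ genSet m ↑X = T}

/-- The idempotent rank of `T`: the least size of a generating set consisting
of idempotents. -/
noncomputable def idrnk {γ : Type*} (m : γ → γ → γ) (T : Set γ) : ℕ :=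
  sInf {k | ∃ X : Finset γ, X.card = k ∧ (∀ x ∈ X, m x x = x) ∧ genSet m ↑X = T}

/-- `T` is idempotent-generated. -/
def IdptGen {γ : Type*} (m : γ → γ → γ) (T : Set γ) : Prop :=
  genSet m {x ∈ T | m x x = x} = T

open Dgm
/-- `a(m)`: `a(0) = a(1) = 1` and `a(m) = a(m-1) + (m-1)·a(m-2)`. -/
def aSeq : ℕ → ℕ
  | 0 => 1
  | 1 => 1
  | (m + 2) => aSeq (m + 1) + (m + 1) * aSeq m

/-- The double factorial `k!!`, with the convention `k!! = 0` for even `k ≥ 0`. -/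
def oddDF : ℕ → ℕ
  | 0 => 0
  | 1 => 1
  | (k + 2) => (k + 2) * oddDF k

namespace Dgm

variable {n : ℕ}

/-- `{x}` is a singleton upper block of `α`. -/
def UpperSingleton (α : Dgm n) (x : Fin n) : Prop :=
  ∀ y : PBV n, α.r (Sum.inl x) y → y = Sum.inl x

/-- `{x'}` is a singleton lower block of `α`. -/
def LowerSingleton (α : Dgm n) (x : Fin n) : Prop :=
  ∀ y : PBV n, α.r (Sum.inr x) y → y = Sum.inr x

/-- The upper point `x` is nested: some upper block `{u,v}` has `u < x < v`. -/
def UpperNested (α : Dgm n) (x : Fin n) : Prop :=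
  ∃ u v : Fin n, α.r (Sum.inl u) (Sum.inl v) ∧ u < x ∧ x < v

/-- The lower point `x'` is nested: some lower block `{u',v'}` has `u < x < v`. -/
def LowerNested (α : Dgm n) (x : Fin n) : Prop :=
  ∃ u v : Fin n, α.r (Sum.inr u) (Sum.inr v) ∧ u < x ∧ x < v

/-- `α` has no unnested singleton (upper or lower) block. -/
def NoUnnestedSingleton (α : Dgm n) : Prop :=
  (∀ x, UpperSingleton α x → UpperNested α x) ∧
  (∀ x, LowerSingleton α x → LowerNested α x)

/-- A chain of `d` nested upper hooks of `α` around the upper point `x`: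
`u_{d-1} < ⋯ < u_0 < x < v_0 < ⋯ < v_{d-1}` with each `{u_i, v_i}` a block.
The singleton upper block `{x}` has nesting depth at most `k` iff there is no
such chain of length `k + 1`. -/
def UpperHookChain (α : Dgm n) (x : Fin n) (d : ℕ) : Prop :=
  ∃ u v : Fin d → Fin n,
    (∀ i, α.r (Sum.inl (u i)) (Sum.inl (v i))) ∧
    (∀ i, u i < x ∧ x < v i) ∧ StrictAnti u ∧ StrictMono v

/-- A chain of `d` nested lower hooks of `α` around the lower point `x'`. -/
def LowerHookChain (α : Dgm n) (x : Fin n) (d : ℕ) : Prop :=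
  ∃ u v : Fin d → Fin n,
    (∀ i, α.r (Sum.inr (u i)) (Sum.inr (v i))) ∧
    (∀ i, u i < x ∧ x < v i) ∧ StrictAnti u ∧ StrictMono v

/-- `λ_A`: the planar diagram joining the `k`-th smallest element of `A`
(upper) to `k` (lower), all other blocks being singletons. -/
def lamd (A : Finset (Fin n)) : Dgm n :=
  Setoid.ker (fun x : PBV n =>
    match x with
    | Sum.inl a =>
        if ha : a ∈ A then
          (Sum.inr (((A.orderIsoOfFin rfl).symm ⟨a, ha⟩ : Fin A.card) : ℕ) : ℕ ⊕ ℕ)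
        else Sum.inl (a : ℕ)
    | Sum.inr j => Sum.inr (j : ℕ))

/-- `ρ_A = (λ_A)*`. -/
def rhod (A : Finset (Fin n)) : Dgm n := pstar (lamd A)

/-- The diagram whose 2-element blocks are exactly `{i, (π i)'}` for `i < r`. -/
def permDgm (n r : ℕ) (π : Equiv.Perm (Fin r)) : Dgm n :=
  Setoid.ker (fun x : PBV n =>
    match x with
    | Sum.inl a =>
        if h : (a : ℕ) < r then (Sum.inr ((π ⟨(a : ℕ), h⟩ : Fin r) : ℕ) : ℕ ⊕ ℕ)
        else Sum.inl (a : ℕ)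
    | Sum.inr j => Sum.inr (j : ℕ))

/-- The set `S_{[r]} ⊆ PB_n`. -/
def SBr (n r : ℕ) : Set (Dgm n) := {γ | ∃ π : Equiv.Perm (Fin r), γ = permDgm n r π}

/-- The domain of `α` as a `Finset`. -/
def domFinset (α : Dgm n) : Finset (Fin n) :=
  Finset.univ.filter fun i => i ∈ domSet α

/-- The codomain of `α` as a `Finset`. -/
def codomFinset (α : Dgm n) : Finset (Fin n) :=
  Finset.univ.filter fun i => i ∈ codomSet α

/-- `A ⊆ {1,…,n}` is cosparse: its complement contains no two consecutive
elements. -/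
def CosparseS (A : Set (Fin n)) : Prop :=
  ∀ i j : Fin n, i ∉ A → j ∉ A → (j : ℕ) ≠ (i : ℕ) + 1

/-- `id_A`: the diagram with blocks `{a, a'}` for `a ∈ A`, all other blocks
being singletons. -/
def idd (A : Set (Fin n)) : Dgm n :=
  Setoid.ker (fun x : PBV n =>
    match x with
    | Sum.inl a => if a ∈ A then (Sum.inr (a : ℕ) : ℕ ⊕ ℕ) else Sum.inl (a : ℕ)
    | Sum.inr j => Sum.inr (j : ℕ))

end Dgm

namespace MzR

/-- colourings compatible with a diagram -/
def Resp {n : ℕ} (α : Dgm n) (u v : Fin n → Prop) : Prop :=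
  ∀ x y, α.r x y → (Sum.elim u v x ↔ Sum.elim u v y)

theorem resp_pmul {n : ℕ} (α β : Dgm n) (u v : Fin n → Prop) :
    Resp (pmul α β) u v ↔ ∃ w, Resp α u w ∧ Resp β w v := by
  constructor
  · intro h
    set c : V3 n → Prop := fun p => ∃ x, RGen (prodEdges α β) p (topBot x) ∧ Sum.elim u v x with hc
    have hcc : ∀ p q, RGen (prodEdges α β) p q → (c p ↔ c q) := by
      intro p q hpq
      constructor
      · rintro ⟨x, hx, hx'⟩
        exact ⟨x, hpq.symm.trans hx, hx'⟩
      · rintro ⟨x, hx, hx'⟩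
        exact ⟨x, hpq.trans hx, hx'⟩
    have hct : ∀ y, c (topBot y) ↔ Sum.elim u v y := by
      intro y
      constructor
      · rintro ⟨x, hx, hx'⟩
        exact (h y x hx).2 hx'
      · intro hy
        exact ⟨y, RGen.refl _, hy⟩
    have h1 : ∀ i, u i ↔ c (Sum.inl i) := fun i => (hct (Sum.inl i)).symm
    have h2 : ∀ i, v i ↔ c (Sum.inr (Sum.inr i)) := fun i => (hct (Sum.inr i)).symm
    refine ⟨fun m => c (Sum.inr (Sum.inl m)), ?_, ?_⟩
    · intro x y hxy
      have := hcc (topMid x) (topMid y) (RGen.rel (Or.inl ⟨x, y, hxy, rfl, rfl⟩))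
      rcases x with x | x <;> rcases y with y | y <;> simp only [Sum.elim_inl, Sum.elim_inr, topMid, h1] at this ⊢ <;> exact this
    · intro x y hxy
      have := hcc (midBot x) (midBot y) (RGen.rel (Or.inr ⟨x, y, hxy, rfl, rfl⟩))
      rcases x with x | x <;> rcases y with y | y <;> simp only [Sum.elim_inl, Sum.elim_inr, midBot, h2] at this ⊢ <;> exact this
  · rintro ⟨w, h1, h2⟩ x y hxy
    have key : ∀ p q, RGen (prodEdges α β) p q →
        (Sum.elim u (Sum.elim w v) p ↔ Sum.elim u (Sum.elim w v) q) := by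
      intro p q hpq
      induction hpq with
      | rel h =>
        rcases h with ⟨a, b, hab, rfl, rfl⟩ | ⟨a, b, hab, rfl, rfl⟩
        · have := h1 a b hab
          rcases a with a | a <;> rcases b with b | b <;> exact this
        · have := h2 a b hab
          rcases a with a | a <;> rcases b with b | b <;> exact this
      | refl x => exact Iff.rfl
      | symm _ ih => exact ih.symm
      | trans _ _ ih1 ih2 => exact ih1.trans ih2
    have := key _ _ hxy
    rcases x with a | a <;> rcases y with b | b <;> exact this

theorem le_of_resp {n : ℕ} {α β : Dgm n} (h : ∀ u v, Resp β u v → Resp α u v) :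
    ∀ x y, α.r x y → β.r x y := by
  intro x y hxy
  have h1 : ∀ z, Sum.elim (fun i => β.r x (Sum.inl i)) (fun i => β.r x (Sum.inr i)) z ↔ β.r x z := by
    rintro (z | z) <;> exact Iff.rfl
  have := h (fun i => β.r x (Sum.inl i)) (fun i => β.r x (Sum.inr i)) (by
    intro a b hab
    rw [h1, h1]
    exact ⟨fun h => β.iseqv.trans h hab, fun h => β.iseqv.trans h (β.iseqv.symm hab)⟩) x y hxy
  rw [h1, h1] at this
  exact this.1 (β.iseqv.refl x)

theorem eq_of_resp {n : ℕ} {α β : Dgm n} (h : ∀ u v, Resp α u v ↔ Resp β u v) : α = β :=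
  Setoid.ext fun x y => ⟨le_of_resp (fun u v => (h u v).2) x y, le_of_resp (fun u v => (h u v).1) x y⟩

theorem pmul_assoc {n : ℕ} (α β γ : Dgm n) : pmul (pmul α β) γ = pmul α (pmul β γ) := by
  apply eq_of_resp
  intro u v
  simp only [resp_pmul]
  constructor
  · rintro ⟨w, ⟨z, h1, h2⟩, h3⟩
    exact ⟨z, h1, w, h2, h3⟩
  · rintro ⟨z, h1, w, h2, h3⟩
    exact ⟨w, ⟨z, h1, h2⟩, h3⟩

/-- identity diagram -/
def one (n : ℕ) : Dgm n := Setoid.ker (Sum.elim id id : PBV n → Fin n)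

theorem resp_one {n : ℕ} (u v : Fin n → Prop) : Resp (one n) u v ↔ u = v := by
  constructor
  · intro h
    funext i
    exact propext (h (Sum.inl i) (Sum.inr i) rfl)
  · rintro rfl x y hxy
    have : (Sum.elim id id x : Fin n) = Sum.elim id id y := hxy
    rcases x with x | x <;> rcases y with y | y <;> simp_all

theorem one_pmul {n : ℕ} (α : Dgm n) : pmul (one n) α = α := by
  apply eq_of_resp
  intro u v
  simp [resp_pmul, resp_one]

theorem pmul_one {n : ℕ} (α : Dgm n) : pmul α (one n) = α := by
  apply eq_of_resp
  intro u v
  simp [resp_pmul, resp_one]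

/-- rank n-1 diagrams -/
def tt {m : ℕ} (i j : Fin (m + 1)) : Dgm (m + 1) :=
  Setoid.ker (Sum.elim (i.insertNth (Sum.inr true) Sum.inl) (j.insertNth (Sum.inr false) Sum.inl)
    : PBV (m + 1) → Fin m ⊕ Bool)

theorem resp_tt {m : ℕ} (i j : Fin (m + 1)) (u v : Fin (m + 1) → Prop) :
    Resp (tt i j) u v ↔ ∀ k, (u (i.succAbove k) ↔ v (j.succAbove k)) := by
  constructor
  · intro h k
    refine h (Sum.inl (i.succAbove k)) (Sum.inr (j.succAbove k)) ?_
    show Sum.elim _ _ _ = Sum.elim _ _ _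
    simp
  · intro h x y hxy
    have hxy : Sum.elim _ _ _ = Sum.elim _ _ _ := hxy
    rcases x with x | x <;> rcases y with y | y
    · induction x using Fin.succAboveCases i <;> induction y using Fin.succAboveCases i <;> simp_all
    · induction x using Fin.succAboveCases i <;> induction y using Fin.succAboveCases j <;> simp_all
    · induction x using Fin.succAboveCases j <;> induction y using Fin.succAboveCases i <;> simp_all
    · induction x using Fin.succAboveCases j <;> induction y using Fin.succAboveCases j <;> simp_all

/-- hooks -/
def hh {m : ℕ} (k : Fin m) : Dgm (m + 1) :=
  Setoid.ker (Sum.elim (fun a => if a = k.castSucc ∨ a = k.succ then Sum.inr true else Sum.inl a)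
    (fun a => if a = k.castSucc ∨ a = k.succ then Sum.inr false else Sum.inl a)
    : PBV (m + 1) → Fin (m + 1) ⊕ Bool)

theorem resp_hh {m : ℕ} (k : Fin m) (u v : Fin (m + 1) → Prop) :
    Resp (hh k) u v ↔ (u k.castSucc ↔ u k.succ) ∧ (v k.castSucc ↔ v k.succ) ∧
      ∀ a, a ≠ k.castSucc → a ≠ k.succ → (u a ↔ v a) := by
  constructor
  · intro h
    refine ⟨h (Sum.inl k.castSucc) (Sum.inl k.succ) ?_, h (Sum.inr k.castSucc) (Sum.inr k.succ) ?_, 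
      fun a h1 h2 => h (Sum.inl a) (Sum.inr a) ?_⟩ <;>
    · show Sum.elim _ _ _ = Sum.elim _ _ _
      simp [*]
  · rintro ⟨h1, h2, h3⟩ x y hxy
    have hxy : Sum.elim _ _ _ = Sum.elim _ _ _ := hxy
    rcases x with x | x <;> rcases y with y | y <;> simp only [Sum.elim_inl, Sum.elim_inr] at hxy ⊢ <;>
      split_ifs at hxy with h4 h5 <;> grind

theorem tt_mul {m : ℕ} (i j k : Fin (m + 1)) : pmul (tt i j) (tt j k) = tt i k := by
  apply eq_of_resp
  intro u v
  simp only [resp_pmul, resp_tt]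
  constructor
  · rintro ⟨w, h1, h2⟩ a
    rw [h1, h2]
  · intro h
    refine ⟨j.insertNth True (fun a => u (i.succAbove a)), ?_, ?_⟩ <;> simp [h]

theorem pmul_block {n : ℕ} (α β : Dgm n) (x : Fin n) (hx : x ∉ domSet α) (y : PBV n) :
    (pmul α β).r (Sum.inl x) y ↔ ∃ z, y = Sum.inl z ∧ α.r (Sum.inl x) (Sum.inl z) := by
  constructor
  · intro h
    have hR : Resp (pmul α β) (fun z => α.r (Sum.inl x) (Sum.inl z)) (fun _ => False) := by
      rw [resp_pmul]
      refine ⟨fun _ => False, ?_, ?_⟩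
      · have h1 : ∀ z, Sum.elim (fun z => α.r (Sum.inl x) (Sum.inl z)) (fun _ => False) z ↔ α.r (Sum.inl x) z := by
          rintro (z | z)
          · exact Iff.rfl
          · simp only [Sum.elim_inr, false_iff]
            exact fun h => hx ⟨z, h⟩
        intro a b hab
        rw [h1, h1]
        exact ⟨fun h => α.iseqv.trans h hab, fun h => α.iseqv.trans h (α.iseqv.symm hab)⟩
      · rintro (a | a) (b | b) _ <;> exact Iff.rfl
    have := (hR _ _ h).1 (α.iseqv.refl _)
    rcases y with y | y
    · exact ⟨y, rfl, this⟩
    · exact this.elim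
  · rintro ⟨z, rfl, h⟩
    exact RGen.rel (Or.inl ⟨_, _, h, rfl, rfl⟩)

theorem eq_one {n : ℕ} {α : Dgm n} (hα : α ∈ Mset n) (h : ∀ i, i ∈ domSet α) : α = one n := by
  obtain ⟨hP, hL⟩ := hα
  choose f hf using h
  have hinj : Function.Injective f := by
    intro a b hab
    have h1 := hf a
    have h2 := hf b
    rw [← hab] at h2
    have := hP _ _ _ (α.iseqv.symm h1) (α.iseqv.symm h2)
    simpa using this
  have hm : StrictMono f := by
    intro a b hab
    by_contra hc
    have hne : f a ≠ f b := fun h => hab.ne (hinj h)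
    have hlt : f b < f a := lt_of_le_of_ne (not_lt.1 hc) hne.symm
    refine hL _ _ _ _ (hf a) (hf b) ?_ ?_ ?_ <;> simp only [vpos] <;> omega
  have hid : ∀ i, f i = i := by
    intro i
    have : f = id := by
      have h1 := StrictMono.range_inj (f := f) (g := id) hm strictMono_id
      apply h1.1
      rw [(Finite.surjective_of_injective hinj).range_eq]
      simp
    rw [this]; rfl
  have hf : ∀ i, α.r (Sum.inl i) (Sum.inr i) := fun i => by
    have := hf i
    rwa [hid] at this
  have hcl : ∀ i y, α.r (Sum.inl i) y → y = Sum.inl i ∨ y = Sum.inr i := by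
    intro i y h
    have := hP _ _ _ (hf i) h
    grind
  apply Setoid.ext
  intro x y
  show α.r x y ↔ Sum.elim id id x = Sum.elim id id y
  have e : ∀ x : PBV n, α.r (Sum.inl (Sum.elim id id x)) x := by
    rintro (x | x)
    · exact α.iseqv.refl _
    · exact hf x
  constructor
  · intro h
    have h1 := hcl _ _ (α.iseqv.trans (α.iseqv.trans (e x) h) (α.iseqv.symm (e y)))
    simpa using (show Sum.elim id id y = Sum.elim id id x by simpa using h1).symm
  · intro h
    have := e x
    rw [h] at this
    exact α.iseqv.trans (α.iseqv.symm this) (e y)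

/-- upper non-transversal part -/
def UU {n : ℕ} (α : Dgm n) : Set (Fin n × Fin n) :=
  {p | p.1 ∉ domSet α ∧ α.r (Sum.inl p.1) (Sum.inl p.2)}

theorem UU_mul {n : ℕ} (a b : Dgm n) (ha : a ∈ Mset n) (S : Set (Fin n))
    (h : UU (pmul a b) = S ×ˢ S) : UU a = S ×ˢ S ∨ UU b = S ×ˢ S := by
  by_cases h1 : ∀ i, i ∈ domSet a
  · right
    rw [eq_one ha h1, one_pmul] at h
    exact h
  · left
    push Not at h1
    obtain ⟨x, hx⟩ := h1
    have sub : ∀ p ∈ UU a, p ∈ UU (pmul a b) := by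
      rintro ⟨p, q⟩ ⟨h1, h2⟩
      refine ⟨?_, (pmul_block a b p h1 _).2 ⟨q, rfl, h2⟩⟩
      rintro ⟨z, hz⟩
      obtain ⟨_, h3, _⟩ := (pmul_block a b p h1 _).1 hz
      cases h3
    have hxS : x ∈ S := by
      have := sub (x, x) ⟨hx, a.iseqv.refl _⟩
      rw [h] at this
      exact this.1
    have hS : ∀ z ∈ S, a.r (Sum.inl x) (Sum.inl z) := by
      intro z hz
      have : (x, z) ∈ UU (pmul a b) := by rw [h]; exact ⟨hxS, hz⟩
      obtain ⟨z', h3, h4⟩ := (pmul_block a b x hx _).1 this.2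
      cases h3
      exact h4
    apply Set.Subset.antisymm
    · intro p hp
      rw [← h]
      exact sub p hp
    · rintro ⟨p, q⟩ ⟨hp, hq⟩
      refine ⟨?_, a.iseqv.trans (a.iseqv.symm (hS p hp)) (hS q hq)⟩
      rintro ⟨z, hz⟩
      exact hx ⟨z, a.iseqv.trans (hS p hp) hz⟩

theorem UU_gen {n : ℕ} (X : Set (Dgm n)) (hX : genSet pmul X = Mset n) (S : Set (Fin n)) (a : Dgm n)
    (ha : MClo pmul X a) (h : UU a = S ×ˢ S) : ∃ g ∈ X, UU g = S ×ˢ S := by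
  induction ha with
  | base hx => exact ⟨_, hx, h⟩
  | mul h1 h2 ih1 ih2 =>
    rcases UU_mul _ _ (by rw [← hX]; exact h1) S h with h | h
    · exact ih1 h
    · exact ih2 h

/-- generators -/
def GG {m : ℕ} : Option (Fin (m + 1) ⊕ Fin m) → Dgm (m + 1)
  | none => one _
  | some (Sum.inl i) => tt i (i + 1)
  | some (Sum.inr k) => hh k

/-- their patterns -/
def SS {m : ℕ} : Option (Fin (m + 1) ⊕ Fin m) → Set (Fin (m + 1))
  | none => ∅
  | some (Sum.inl i) => {i}
  | some (Sum.inr k) => {k.castSucc, k.succ}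

theorem SS_inj {m : ℕ} : Function.Injective (SS (m := m)) := by
  have key : ∀ p q : Option (Fin (m + 1) ⊕ Fin m), (∀ x, x ∈ SS p ↔ x ∈ SS q) → p = q := by
    rintro (_ | i | k) (_ | j | l) h
    · rfl
    · have := h j; simp [SS] at this
    · have := h l.succ; simp [SS] at this
    · have := h i; simp [SS] at this
    · have := h i; simp [SS] at this; rw [this]
    · have h1 := h l.succ
      have h2 := h l.castSucc
      simp [SS, Fin.ext_iff] at h1 h2; omega
    · have := h k.succ; simp [SS] at this
    · have h1 := h k.succ
      have h2 := h k.castSucc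
      simp [SS, Fin.ext_iff] at h1 h2; omega
    · have h1 := h k.succ
      have h2 := h k.castSucc
      have h3 := h l.succ
      have h4 := h l.castSucc
      simp [SS, Fin.ext_iff] at h1 h2 h3 h4 ⊢; omega
  intro p q h
  exact key p q fun x => by rw [h]

theorem UU_GG {m : ℕ} (p : Option (Fin (m + 1) ⊕ Fin m)) : UU (GG p) = SS p ×ˢ SS p := by
  have dom1 : ∀ (i j a : Fin (m + 1)), a ∉ domSet (tt i j) ↔ a = i := by
    intro i j a
    have : ∀ a, a ∈ domSet (tt i j) ↔ ∃ b, 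
      (i.insertNth (α := fun _ => Fin m ⊕ Bool) (Sum.inr true) Sum.inl a : Fin m ⊕ Bool) = j.insertNth (α := fun _ => Fin m ⊕ Bool) (Sum.inr false) Sum.inl b := fun a => Iff.rfl
    rw [this]
    induction a using Fin.succAboveCases i with
    | x => 
      simp only [Fin.insertNth_apply_same, not_exists, iff_true]
      intro b
      induction b using Fin.succAboveCases j <;> simp
    | p k =>
      simp only [Fin.insertNth_apply_succAbove, not_exists, (Fin.succAbove_ne i k), iff_false, not_forall, not_not]
      exact ⟨j.succAbove k, by simp⟩
  have dom2 : ∀ (k : Fin m) a, a ∉ domSet (hh k) ↔ a = k.castSucc ∨ a = k.succ := by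
    intro k a
    have : ∀ a, a ∈ domSet (hh k) ↔ ∃ b, (if a = k.castSucc ∨ a = k.succ then Sum.inr true else Sum.inl a : Fin (m+1) ⊕ Bool)
      = (if b = k.castSucc ∨ b = k.succ then Sum.inr false else Sum.inl b) := fun a => Iff.rfl
    rw [this]
    constructor
    · intro h
      by_contra hc
      exact h ⟨a, by simp [hc]⟩
    · rintro h ⟨b, hb⟩
      rw [if_pos h] at hb
      split_ifs at hb
      simp at hb
  ext ⟨a, b⟩
  simp only [UU, Set.mem_ofPred_eq, Set.mem_prod]
  rcases p with _ | i | k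
  · simp only [GG, SS]
    simp only [Set.mem_empty_iff_false, false_and, iff_false, not_and]
    intro h
    exact absurd ⟨a, rfl⟩ h
  · simp only [GG, SS, dom1, Set.mem_singleton_iff, and_congr_right_iff]
    rintro rfl
    show (a.insertNth (α := fun _ => Fin m ⊕ Bool) (Sum.inr true) Sum.inl a : Fin m ⊕ Bool) = a.insertNth (α := fun _ => Fin m ⊕ Bool) (Sum.inr true) Sum.inl b ↔ _
    induction b using Fin.succAboveCases a <;> simp
  · simp only [GG, SS, dom2, Set.mem_insert_iff, Set.mem_singleton_iff, and_congr_right_iff]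
    intro h
    show (if a = k.castSucc ∨ a = k.succ then Sum.inr true else Sum.inl a : Fin (m+1) ⊕ Bool)
      = (if b = k.castSucc ∨ b = k.succ then Sum.inr true else Sum.inl b) ↔ _
    rw [if_pos h]
    split_ifs with h2 <;> simp [h2]

theorem lower_bound {m : ℕ} (hG : ∀ p, GG (m := m) p ∈ Mset (m + 1)) (X : Finset (Dgm (m + 1)))
    (hX : genSet pmul (X : Set (Dgm (m + 1))) = Mset (m + 1)) : 2 * (m + 1) ≤ X.card := by
  have h : ∀ p : Option (Fin (m + 1) ⊕ Fin m), ∃ g : X, UU g.1 = SS p ×ˢ SS p := by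
    intro p
    have hm : MClo pmul (X : Set (Dgm (m + 1))) (GG p) := by
      have := hG p
      rw [← hX] at this
      exact this
    obtain ⟨g, hg, h⟩ := UU_gen _ hX (SS p) (GG p) hm (UU_GG p)
    exact ⟨⟨g, hg⟩, h⟩
  choose f hf using h
  have hinj : Function.Injective f := by
    intro p q hpq
    apply SS_inj
    have h1 := hf p
    rw [hpq, hf q] at h1
    ext x
    have := Set.ext_iff.1 h1 (x, x)
    simpa using this.symm
  have := Fintype.card_le_of_injective f hinj
  simp at this
  omega

theorem vpos_inj {n : ℕ} : Function.Injective (vpos (n := n)) := by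
  rintro (x | x) (y | y) h <;> simp only [vpos] at h
  · rw [Fin.ext h]
  · omega
  · omega
  · congr 1; apply Fin.ext; omega

theorem nest {n : ℕ} {α : Dgm n} (hL : IsPlanar α) {a b c d : PBV n} (h1 : α.r a b) (h2 : α.r c d)
    (h3 : vpos a < vpos c) (h4 : vpos c < vpos b) : vpos a ≤ vpos d ∧ vpos d ≤ vpos b := by
  constructor
  · by_contra hc
    exact hL d c a b (α.iseqv.symm h2) h1 (by omega) h3 h4
  · by_contra hc
    exact hL a b c d h1 h2 h3 h4 (by omega)

theorem Mset_anti {n : ℕ} {α β : Dgm n} (h : ∀ x y, α.r x y → β.r x y) (hβ : β ∈ Mset n) :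
    α ∈ Mset n :=
  ⟨fun x y z h1 h2 => hβ.1 x y z (h _ _ h1) (h _ _ h2),
    fun a b c d h1 h2 => hβ.2 a b c d (h _ _ h1) (h _ _ h2)⟩

/-- order preserving off `j`, sends `j` to `i` -/
def gg {m : ℕ} (j i : Fin (m + 1)) : Fin (m + 1) → Fin (m + 1) :=
  j.insertNth (α := fun _ => Fin (m + 1)) i i.succAbove

theorem gg_same {m : ℕ} (j i : Fin (m + 1)) : gg j i j = i := by simp [gg]
theorem gg_sA {m : ℕ} (j i : Fin (m + 1)) (k) : gg j i (j.succAbove k) = i.succAbove k := by simp [gg]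
theorem gg_gg {m : ℕ} (j i a : Fin (m + 1)) : gg i j (gg j i a) = a := by
  induction a using Fin.succAboveCases j <;> simp [gg_same, gg_sA]
theorem gg_self {m : ℕ} (i a : Fin (m + 1)) : gg i i a = a := by
  induction a using Fin.succAboveCases i <;> simp [gg_same, gg_sA]
theorem gg_lt {m : ℕ} (j i : Fin (m + 1)) {a b : Fin (m + 1)} (ha : a ≠ j) (hb : b ≠ j) (h : a < b) :
    gg j i a < gg j i b := by
  induction a using Fin.succAboveCases j with
  | x => exact absurd rfl ha
  | p a =>
    induction b using Fin.succAboveCases j with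
    | x => exact absurd rfl hb
    | p b =>
      rw [gg_sA, gg_sA]
      rw [Fin.succAbove_lt_succAbove_iff] at h ⊢
      exact h

/-- relabelling of vertices -/
def ph {m : ℕ} (i i' j j' : Fin (m + 1)) : PBV (m + 1) → PBV (m + 1) :=
  Sum.map (gg i i') (gg j j')

theorem ph_ph {m : ℕ} (i i' j j' : Fin (m + 1)) (x) : ph i' i j' j (ph i i' j j' x) = x := by
  rcases x with x | x <;> simp [ph, gg_gg]

theorem ph_inj {m : ℕ} (i i' j j' : Fin (m + 1)) : Function.Injective (ph i i' j j') :=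
  Function.LeftInverse.injective (ph_ph i i' j j')

theorem ph_lt {m : ℕ} (i i' j j' : Fin (m + 1)) {x y : PBV (m + 1)}
    (hx : x ≠ Sum.inl i) (hy : y ≠ Sum.inl i) (hx' : x ≠ Sum.inr j) (hy' : y ≠ Sum.inr j)
    (h : vpos x < vpos y) : vpos (ph i i' j j' x) < vpos (ph i i' j j' y) := by
  rcases x with x | x <;> rcases y with y | y <;> simp only [ph, Sum.map_inl, Sum.map_inr, vpos] at h ⊢
  · exact gg_lt i i' (by simpa using hx) (by simpa using hy) h
  · omega
  · omega
  · have := gg_lt j j' (a := y) (b := x) (by simpa using hy') (by simpa using hx') (by omega)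
    omega

theorem ph_lt' {m : ℕ} (i j j' : Fin (m + 1)) {x y : PBV (m + 1)}
    (hx' : x ≠ Sum.inr j) (hy' : y ≠ Sum.inr j)
    (h : vpos x < vpos y) : vpos (ph i i j j' x) < vpos (ph i i j j' y) := by
  have e : ∀ a, gg i i a = a := gg_self i
  rcases x with x | x <;> rcases y with y | y <;> simp only [ph, Sum.map_inl, Sum.map_inr, vpos, e] at h ⊢
  · exact h
  · omega
  · omega
  · have := gg_lt j j' (a := y) (b := x) (by simpa using hy') (by simpa using hx') (by omega)
    omega

/-- upper bound for `α * tt i j` -/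
def gT {m : ℕ} (α : Dgm (m + 1)) (i j : Fin (m + 1)) : Dgm (m + 1) where
  r x y := x = y ∨ (x ≠ Sum.inr j ∧ y ≠ Sum.inr j ∧ α.r (ph 0 0 j i x) (ph 0 0 j i y))
  iseqv := by
    refine ⟨fun _ => Or.inl rfl, ?_, ?_⟩
    · rintro x y (h | ⟨h1, h2, h3⟩)
      · exact Or.inl h.symm
      · exact Or.inr ⟨h2, h1, α.iseqv.symm h3⟩
    · rintro x y z (rfl | ⟨h1, h2, h3⟩) (rfl | ⟨h4, h5, h6⟩)
      · exact Or.inl rfl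
      · exact Or.inr ⟨h4, h5, h6⟩
      · exact Or.inr ⟨h1, h2, h3⟩
      · exact Or.inr ⟨h1, h5, α.iseqv.trans h3 h6⟩

theorem gT_mem {m : ℕ} {α : Dgm (m + 1)} (hα : α ∈ Mset (m + 1)) (i j : Fin (m + 1)) :
    gT α i j ∈ Mset (m + 1) := by
  constructor
  · rintro x y z (h | ⟨h1, h2, h3⟩) (h' | ⟨h4, h5, h6⟩)
    · exact Or.inl h
    · exact Or.inl h
    · exact Or.inr (Or.inl h')
    · have := hα.1 _ _ _ h3 h6
      simpa only [(ph_inj _ _ _ _).eq_iff] using this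
  · rintro a b c d (rfl | ⟨h1, h2, h3⟩) (rfl | ⟨h4, h5, h6⟩) h7 h8 h9
    · omega
    · omega
    · omega
    · exact hα.2 _ _ _ _ h3 h6 (ph_lt' _ _ _ h1 h4 h7) (ph_lt' _ _ _ h4 h2 h8) (ph_lt' _ _ _ h2 h5 h9)

theorem mul_tt_mem {m : ℕ} {α : Dgm (m + 1)} (hα : α ∈ Mset (m + 1)) (i j : Fin (m + 1)) :
    pmul α (tt i j) ∈ Mset (m + 1) := by
  refine Mset_anti (le_of_resp ?_) (gT_mem hα i j)
  intro u v h
  rw [resp_pmul]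
  set w : Fin (m + 1) → Prop := fun a => if a = i then
    (∃ x, x ≠ Sum.inr i ∧ α.r (Sum.inr i) x ∧ Sum.elim u v (ph 0 0 i j x)) else v (gg i j a) with hw
  have e : ∀ a : Fin (m + 1), gg 0 0 a = a := gg_self 0
  have hW : ∀ x, x ≠ Sum.inr i → (Sum.elim u w x ↔ Sum.elim u v (ph 0 0 i j x)) := by
    rintro (x | x) hx
    · simp [ph, e]
    · have : x ≠ i := by simpa using hx
      simp [ph, hw, this]
  have hI : w i ↔ (∃ x, x ≠ Sum.inr i ∧ α.r (Sum.inr i) x ∧ Sum.elim u v (ph 0 0 i j x)) := by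
    simp [hw]
  have hone : ∀ y, y ≠ Sum.inr i → α.r (Sum.inr i) y → (w i ↔ Sum.elim u w y) := by
    intro y hy hr
    rw [hI, hW y hy]
    constructor
    · rintro ⟨x, h1, h2, h3⟩
      have := hα.1 _ _ _ hr h2
      have : y = x := by
        rcases this with h | h | h
        · exact absurd h.symm hy
        · exact absurd h.symm h1
        · exact h
      rwa [this]
    · intro h3
      exact ⟨y, hy, hr, h3⟩
  refine ⟨w, ?_, ?_⟩
  · intro x y hxy
    by_cases hx : x = Sum.inr i
    · by_cases hy : y = Sum.inr i
      · rw [hx, hy]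
      · subst hx
        exact hone y hy hxy
    · by_cases hy : y = Sum.inr i
      · subst hy
        exact (hone x hx (α.iseqv.symm hxy)).symm
      · rw [hW x hx, hW y hy]
        have hne : ∀ x, x ≠ Sum.inr i → ph 0 0 i j x ≠ Sum.inr j := by
          intro x hx h
          apply hx
          apply ph_inj 0 0 i j
          rw [h]; simp [ph, gg_same]
        apply h
        right
        refine ⟨hne x hx, hne y hy, ?_⟩
        rw [ph_ph, ph_ph]
        exact hxy
  · rw [resp_tt]
    intro k
    simp [hw, gg_sA, Fin.succAbove_ne]

/-- lower vertices of a hook -/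
def KK {m : ℕ} (k : Fin m) (x : PBV (m + 1)) : Prop := x = Sum.inr k.castSucc ∨ x = Sum.inr k.succ
/-- attached to the hook -/
def QQ {m : ℕ} (α : Dgm (m + 1)) (k : Fin m) (x : PBV (m + 1)) : Prop :=
  α.r x (Sum.inr k.castSucc) ∨ α.r x (Sum.inr k.succ)

theorem QQ_tr {m : ℕ} {α : Dgm (m + 1)} {k : Fin m} {x y} (h : α.r x y) (hy : QQ α k y) : QQ α k x :=
  hy.imp (fun h' => α.iseqv.trans h h') (fun h' => α.iseqv.trans h h')

/-- bound for `α * hh k` -/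
def gH {m : ℕ} (α : Dgm (m + 1)) (k : Fin m) : Dgm (m + 1) where
  r x y := x = y ∨ (KK k x ∧ KK k y) ∨ (¬ KK k x ∧ ¬ KK k y ∧ (α.r x y ∨ (QQ α k x ∧ QQ α k y)))
  iseqv := by
    refine ⟨fun _ => Or.inl rfl, ?_, ?_⟩
    · rintro x y (h | ⟨h1, h2⟩ | ⟨h1, h2, h3⟩)
      · exact Or.inl h.symm
      · exact Or.inr (Or.inl ⟨h2, h1⟩)
      · exact Or.inr (Or.inr ⟨h2, h1, h3.imp (fun h => α.iseqv.symm h) And.symm⟩)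
    · rintro x y z (rfl | ⟨h1, h2⟩ | ⟨h1, h2, h3⟩) (rfl | ⟨h4, h5⟩ | ⟨h4, h5, h6⟩)
      · exact Or.inl rfl
      · exact Or.inr (Or.inl ⟨h4, h5⟩)
      · exact Or.inr (Or.inr ⟨h4, h5, h6⟩)
      · exact Or.inr (Or.inl ⟨h1, h2⟩)
      · exact Or.inr (Or.inl ⟨h1, h5⟩)
      · exact absurd h2 h4
      · exact Or.inr (Or.inr ⟨h1, h2, h3⟩)
      · exact absurd h4 h2
      · refine Or.inr (Or.inr ⟨h1, h5, ?_⟩)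
        rcases h3 with h3 | ⟨h3, h3'⟩ <;> rcases h6 with h6 | ⟨h6, h6'⟩
        · exact Or.inl (α.iseqv.trans h3 h6)
        · exact Or.inr ⟨QQ_tr h3 h6, h6'⟩
        · exact Or.inr ⟨h3, QQ_tr (α.iseqv.symm h6) h3'⟩
        · exact Or.inr ⟨h3, h6'⟩

theorem gH_mem {m : ℕ} {α : Dgm (m + 1)} (hα : α ∈ Mset (m + 1)) (k : Fin m) :
    gH α k ∈ Mset (m + 1) := by
  obtain ⟨hP, hL⟩ := hα
  have hu : ∀ x y p, α.r x p → α.r y p → x ≠ p → y ≠ p → x = y := by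
    intro x y p h1 h2 h3 h4
    rcases hP p x y (α.iseqv.symm h1) (α.iseqv.symm h2) with h | h | h
    · exact absurd h.symm h3
    · exact absurd h.symm h4
    · exact h
  have hsy : ∀ x y, α.r x y → α.r y x := fun x y h => α.iseqv.symm h
  constructor
  · rintro x y z (h | ⟨h1, h2⟩ | ⟨h1, h2, h3⟩) (h' | ⟨h4, h5⟩ | ⟨h4, h5, h6⟩)
    · exact Or.inl h
    · exact Or.inl h
    · exact Or.inl h
    · exact Or.inr (Or.inl h')
    · unfold KK at *; grind
    · exact absurd h1 h4
    · exact Or.inr (Or.inl h')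
    · exact absurd h4 h1
    · unfold KK at *
      unfold QQ at *
      have := hP x y z
      grind
  · have hadj : vpos (Sum.inr k.castSucc : PBV (m + 1)) = vpos (Sum.inr k.succ : PBV (m + 1)) + 1 := by
      simp [vpos]; omega
    rintro a b c d (rfl | ⟨h1, h2⟩ | ⟨h1, h2, h3⟩) (rfl | ⟨h4, h5⟩ | ⟨h4, h5, h6⟩) h7 h8 h9
    any_goals omega
    · rcases h1 with rfl | rfl <;> rcases h2 with rfl | rfl <;>
      rcases h4 with rfl | rfl <;> rcases h5 with rfl | rfl <;> omega
    · rcases h1 with rfl | rfl <;> rcases h2 with rfl | rfl <;> omega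
    · rcases h4 with rfl | rfl <;> rcases h5 with rfl | rfl <;> omega
    · have hne : ∀ x, ¬ KK k x → vpos x ≠ vpos (Sum.inr k.castSucc : PBV (m + 1)) ∧
          vpos x ≠ vpos (Sum.inr k.succ : PBV (m + 1)) := by
        intro x hx
        exact ⟨fun h => hx (Or.inl (vpos_inj h)), fun h => hx (Or.inr (vpos_inj h))⟩
      have na := hne a h1
      have nb := hne b h2
      have nc := hne c h4
      have nd := hne d h5
      have hdiff : ∀ x y, QQ α k x → QQ α k y → ¬ KK k x → ¬ KK k y → x ≠ y → 
        (α.r x (Sum.inr k.castSucc) ∧ α.r y (Sum.inr k.succ)) ∨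
        (α.r x (Sum.inr k.succ) ∧ α.r y (Sum.inr k.castSucc)) := by
        intro x y hx hy kx ky hxy
        unfold KK at *
        unfold QQ at *
        grind
      have hnab : a ≠ b := by rintro rfl; omega
      have hncd : c ≠ d := by rintro rfl; omega
      rcases h3 with h3 | ⟨h3, h3'⟩ <;> rcases h6 with h6 | ⟨h6, h6'⟩
      · exact hL _ _ _ _ h3 h6 h7 h8 h9
      · rcases hdiff c d h6 h6' h4 h5 hncd with ⟨g1, g2⟩ | ⟨g1, g2⟩
        · have t1 := nest hL h3 g1 h7 h8
          have t2 := nest hL h3 (hsy _ _ g2) (by omega) (by omega)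
          omega
        · have t1 := nest hL h3 g1 h7 h8
          have t2 := nest hL h3 (hsy _ _ g2) (by omega) (by omega)
          omega
      · rcases hdiff a b h3 h3' h1 h2 hnab with ⟨g1, g2⟩ | ⟨g1, g2⟩
        · have t1 := nest hL h6 g2 h8 h9
          have t2 := nest hL h6 (hsy _ _ g1) (by omega) (by omega)
          omega
        · have t1 := nest hL h6 g2 h8 h9
          have t2 := nest hL h6 (hsy _ _ g1) (by omega) (by omega)
          omega
      · have hac : a ≠ c := by rintro rfl; omega
        have hbc : b ≠ c := by rintro rfl; omega
        have hd1 := hdiff a b h3 h3' h1 h2 hnab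
        have hd2 := hdiff a c h3 h6 h1 h4 hac
        have hd3 := hdiff b c h3' h6 h2 h4 hbc
        unfold KK at *
        grind

theorem mul_hh_mem {m : ℕ} {α : Dgm (m + 1)} (hα : α ∈ Mset (m + 1)) (k : Fin m) :
    pmul α (hh k) ∈ Mset (m + 1) := by
  refine Mset_anti (le_of_resp ?_) (gH_mem hα k)
  intro u v h
  rw [resp_pmul]
  set w : Fin (m + 1) → Prop := fun a => if KK k (Sum.inr a) then
    (∃ x, ¬ KK k x ∧ QQ α k x ∧ Sum.elim u v x) else v a with hw
  have hW : ∀ x, ¬ KK k x → (Sum.elim u w x ↔ Sum.elim u v x) := by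
    rintro (x | x) hx
    · simp
    · simp [hw, hx]
  have hI : ∀ x, KK k x → (Sum.elim u w x ↔ (∃ x, ¬ KK k x ∧ QQ α k x ∧ Sum.elim u v x)) := by
    rintro (x | x) hx
    · simp [KK] at hx
    · simp [hw, hx]
  have hone : ∀ x y, KK k x → ¬ KK k y → α.r y x → (Sum.elim u w x ↔ Sum.elim u w y) := by
    intro x y hx hy hr
    have hQ : QQ α k y := by
      rcases hx with rfl | rfl
      · exact Or.inl hr
      · exact Or.inr hr
    rw [hI x hx, hW y hy]
    constructor
    · rintro ⟨z, h1, h2, h3⟩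
      exact (h z y (Or.inr (Or.inr ⟨h1, hy, Or.inr ⟨h2, hQ⟩⟩))).1 h3
    · intro h3
      exact ⟨y, hy, hQ, h3⟩
  refine ⟨w, ?_, ?_⟩
  · intro x y hxy
    by_cases hx : KK k x <;> by_cases hy : KK k y
    · rw [hI x hx, hI y hy]
    · exact hone x y hx hy (α.iseqv.symm hxy)
    · exact (hone y x hy hx hxy).symm
    · rw [hW x hx, hW y hy]
      exact h x y (Or.inr (Or.inr ⟨hx, hy, Or.inl hxy⟩))
  · rw [resp_hh]
    refine ⟨(hI (Sum.inr k.castSucc) (Or.inl rfl)).trans (hI (Sum.inr k.succ) (Or.inr rfl)).symm,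
      h (Sum.inr k.castSucc) (Sum.inr k.succ) (Or.inr (Or.inl ⟨Or.inl rfl, Or.inr rfl⟩)), ?_⟩
    intro a h1 h2
    exact hW (Sum.inr a) (by simp [KK, h1, h2])

theorem one_mem (n : ℕ) : one n ∈ Mset n := by
  have e : ∀ x y, (one n).r x y → Sum.elim id id x = (Sum.elim id id y : Fin n) := fun x y h => h
  constructor
  · intro x y z h1 h2
    have h1 := e _ _ h1
    have h2 := e _ _ h2
    rcases x with x | x <;> rcases y with y | y <;> rcases z with z | z <;> simp at h1 h2 ⊢ <;> grind
  · intro a b c d h1 h2 h3 h4 h5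
    have h1 := e _ _ h1
    have h2 := e _ _ h2
    rcases a with a | a <;> rcases b with b | b <;> rcases c with c | c <;> rcases d with d | d <;>
      simp [vpos] at h1 h2 h3 h4 h5 <;> subst h1 <;> subst h2 <;> omega

theorem GG_mul_mem {m : ℕ} {α : Dgm (m + 1)} (hα : α ∈ Mset (m + 1)) (p) :
    pmul α (GG p) ∈ Mset (m + 1) := by
  rcases p with _ | i | k
  · show pmul α (one _) ∈ _
    rwa [pmul_one]
  · exact mul_tt_mem hα _ _
  · exact mul_hh_mem hα _

theorem clo_mul_mem {m : ℕ} {β : Dgm (m + 1)} (h : MClo pmul (Set.range (GG (m := m))) β) :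
    ∀ α ∈ Mset (m + 1), pmul α β ∈ Mset (m + 1) := by
  induction h with
  | base h =>
    obtain ⟨p, rfl⟩ := h
    exact fun α hα => GG_mul_mem hα p
  | mul _ _ ih1 ih2 =>
    intro α hα
    rw [← pmul_assoc]
    exact ih2 _ (ih1 _ hα)

theorem clo_mem {m : ℕ} {β : Dgm (m + 1)} (h : MClo pmul (Set.range (GG (m := m))) β) :
    β ∈ Mset (m + 1) := by
  have := clo_mul_mem h _ (one_mem _)
  rwa [one_pmul] at this

/-- in the closure of the generators -/
abbrev CC {m : ℕ} (β : Dgm (m + 1)) : Prop := MClo pmul (Set.range (GG (m := m))) β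

theorem CC_tt {m : ℕ} (i j : Fin (m + 1)) : CC (tt i j) := by
  have h : ∀ (d i : Fin (m + 1)), CC (tt i (i + d + 1)) := by
    intro d
    induction d using Fin.induction with
    | zero =>
      intro i
      rw [add_zero]
      exact MClo.base ⟨some (Sum.inl i), rfl⟩
    | succ d ih =>
      intro i
      have h1 := MClo.mul (ih i) (MClo.base (m := pmul) ⟨some (Sum.inl (i + d.castSucc + 1)), rfl⟩)
      rw [← Fin.coeSucc_eq_succ, ← add_assoc]
      have h2 : pmul (tt i (i + d.castSucc + 1)) (GG (some (Sum.inl (i + d.castSucc + 1)))) =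
        tt i (i + d.castSucc + 1 + 1) := tt_mul _ _ _
      rw [← h2]
      exact h1
  have := h (j - i - 1) i
  have e : i + (j - i - 1) + 1 = j := by abel
  rwa [e] at this

/-- removing a hook -/
def rem {n : ℕ} (α : Dgm n) (p q : PBV n) : Dgm n where
  r x y := x = y ∨ (α.r x y ∧ x ≠ p ∧ x ≠ q ∧ y ≠ p ∧ y ≠ q)
  iseqv := by
    refine ⟨fun _ => Or.inl rfl, ?_, ?_⟩
    · rintro x y (h | ⟨h1, h2, h3, h4, h5⟩)
      · exact Or.inl h.symm
      · exact Or.inr ⟨α.iseqv.symm h1, h4, h5, h2, h3⟩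
    · rintro x y z (rfl | ⟨h1, h2, h3, h4, h5⟩) (rfl | ⟨h1', h2', h3', h4', h5'⟩)
      · exact Or.inl rfl
      · exact Or.inr ⟨h1', h2', h3', h4', h5'⟩
      · exact Or.inr ⟨h1, h2, h3, h4, h5⟩
      · exact Or.inr ⟨α.iseqv.trans h1 h1', h2, h3, h4', h5'⟩

theorem rem_le {n : ℕ} (α : Dgm n) (p q : PBV n) : ∀ x y, (rem α p q).r x y → α.r x y := by
  rintro x y (rfl | h)
  · exact α.iseqv.refl _
  · exact h.1

/-- non-transversal vertices -/
def NN {n : ℕ} (α : Dgm n) : Set (PBV n) := {x | ∀ y, α.r x y → y.isLeft = x.isLeft}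
/-- hook vertices -/
def HH {n : ℕ} (α : Dgm n) : Set (PBV n) := {x | ∃ y, y ≠ x ∧ α.r x y ∧ y.isLeft = x.isLeft}
/-- the measure -/
def mu {n : ℕ} (α : Dgm n) : ℕ := (NN α).ncard + (HH α).ncard

/-- the two ends of a hook -/
theorem hook_cases {n : ℕ} {α : Dgm n} (hP : IsPB α) {p q : PBV n} (h : α.r p q) (hne : p ≠ q) {x y}
    (hxy : α.r x y) : ((x = p ∨ x = q) ∧ (y = p ∨ y = q)) ∨ (x ≠ p ∧ x ≠ q ∧ y ≠ p ∧ y ≠ q) := by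
  have h1 := hP p q
  have h2 := hP q p
  have hs : ∀ a b, α.r a b → α.r b a := fun a b h => α.iseqv.symm h
  grind

theorem mu_rem {n : ℕ} {α : Dgm n} (hP : IsPB α) {p q : PBV n} (h : α.r p q) (hne : p ≠ q)
    (hs : p.isLeft = q.isLeft) : mu (rem α p q) < mu α := by
  have h1 : (NN (rem α p q)).ncard ≤ (NN α).ncard := by
    apply Set.ncard_le_ncard _ (Set.toFinite _)
    intro x hx y hxy
    rcases hook_cases hP h hne hxy with ⟨h1, h2⟩ | h1
    · grind
    · exact hx y (Or.inr ⟨hxy, h1⟩)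
  have h2 : (HH (rem α p q)).ncard < (HH α).ncard := by
    apply Set.ncard_lt_ncard _ (Set.toFinite _)
    rw [Set.ssubset_iff_of_subset]
    · refine ⟨p, ⟨q, hne.symm, h, hs.symm⟩, ?_⟩
      rintro ⟨y, h1, h2 | h2, h3⟩
      · exact h1 h2.symm
      · exact h2.2.1 rfl
    · rintro x ⟨y, h1, h2, h3⟩
      exact ⟨y, h1, rem_le _ _ _ _ _ h2, h3⟩
  unfold mu; omega

theorem hook_upper {m : ℕ} {α : Dgm (m + 1)} (hP : IsPB α) (k : Fin m)
    (h : α.r (Sum.inl k.castSucc) (Sum.inl k.succ)) :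
    α = pmul (hh k) (rem α (Sum.inl k.castSucc) (Sum.inl k.succ)) := by
  have hne : (Sum.inl k.castSucc : PBV (m + 1)) ≠ Sum.inl k.succ := by simp [Fin.ext_iff]
  apply eq_of_resp
  intro u v
  rw [resp_pmul]
  constructor
  · intro hR
    refine ⟨u, ?_, fun x y hxy => hR x y (rem_le _ _ _ _ _ hxy)⟩
    rw [resp_hh]
    exact ⟨hR _ _ h, hR _ _ h, fun _ _ _ => Iff.rfl⟩
  · rintro ⟨w, h1, h2⟩ x y hxy
    rw [resp_hh] at h1
    rcases hook_cases hP h hne hxy with ⟨g1, g2⟩ | hg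
    · rcases g1 with rfl | rfl <;> rcases g2 with rfl | rfl <;> simp [h1.1]
    · have := h2 x y (Or.inr ⟨hxy, hg⟩)
      have e : ∀ z, z ≠ Sum.inl k.castSucc → z ≠ Sum.inl k.succ → (Sum.elim u v z ↔ Sum.elim w v z) := by
        rintro (z | z) g1 g2
        · exact h1.2.2 z (by simpa using g1) (by simpa using g2)
        · exact Iff.rfl
      rw [e x hg.1 hg.2.1, e y hg.2.2.1 hg.2.2.2]
      exact this

theorem hook_lower {m : ℕ} {α : Dgm (m + 1)} (hP : IsPB α) (k : Fin m)
    (h : α.r (Sum.inr k.castSucc) (Sum.inr k.succ)) :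
    α = pmul (rem α (Sum.inr k.castSucc) (Sum.inr k.succ)) (hh k) := by
  have hne : (Sum.inr k.castSucc : PBV (m + 1)) ≠ Sum.inr k.succ := by simp [Fin.ext_iff]
  apply eq_of_resp
  intro u v
  rw [resp_pmul]
  constructor
  · intro hR
    refine ⟨v, fun x y hxy => hR x y (rem_le _ _ _ _ _ hxy), ?_⟩
    rw [resp_hh]
    exact ⟨hR _ _ h, hR _ _ h, fun _ _ _ => Iff.rfl⟩
  · rintro ⟨w, h2, h1⟩ x y hxy
    rw [resp_hh] at h1
    rcases hook_cases hP h hne hxy with ⟨g1, g2⟩ | hg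
    · rcases g1 with rfl | rfl <;> rcases g2 with rfl | rfl <;> simp [h1.2.1]
    · have := h2 x y (Or.inr ⟨hxy, hg⟩)
      have e : ∀ z, z ≠ Sum.inr k.castSucc → z ≠ Sum.inr k.succ → (Sum.elim u v z ↔ Sum.elim u w z) := by
        rintro (z | z) g1 g2
        · exact Iff.rfl
        · exact (h1.2.2 z (by simpa using g1) (by simpa using g2)).symm
      rw [e x hg.1 hg.2.1, e y hg.2.2.1 hg.2.2.2]
      exact this

theorem vpos_side {n : ℕ} (x : PBV n) : x.isLeft = decide (vpos x < n) := by
  rcases x with x | x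
  · simp [vpos]
  · have : ¬ vpos (Sum.inr x : PBV n) < n := by simp only [vpos]; omega
    simp [this]

/-- if a side has a hook and no singletons, it has an adjacent hook -/
theorem exists_adj {n : ℕ} {α : Dgm n} (hα : α ∈ Mset n) (s : Bool)
    (hs : ∀ x, x.isLeft = s → ∃ y, y ≠ x ∧ α.r x y)
    (d : ℕ) : ∀ a b : PBV n, a.isLeft = s → b.isLeft = s → α.r a b → vpos a < vpos b → vpos b - vpos a ≤ d →
      ∃ a b : PBV n, a.isLeft = s ∧ b.isLeft = s ∧ α.r a b ∧ vpos b = vpos a + 1 := by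
  have hsurj : ∀ p, p < 2 * n → ∃ x : PBV n, vpos x = p := by
    intro p hp
    by_cases h : p < n
    · exact ⟨Sum.inl ⟨p, h⟩, rfl⟩
    · refine ⟨Sum.inr ⟨2 * n - 1 - p, by omega⟩, ?_⟩
      simp only [vpos]; omega
  have hb2 : ∀ x : PBV n, vpos x < 2 * n := by
    rintro (x | x) <;> simp only [vpos] <;> omega
  induction d with
  | zero => intro a b _ _ _ h1 h2; omega
  | succ d ih =>
    intro a b ha hb hab h1 h2
    by_cases h3 : vpos b = vpos a + 1
    · exact ⟨a, b, ha, hb, hab, h3⟩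
    · obtain ⟨c, hc⟩ := hsurj (vpos a + 1) (by have := hb2 b; omega)
      have side : ∀ c : PBV n, vpos a ≤ vpos c → vpos c ≤ vpos b → c.isLeft = s := by
        intro c g1 g2
        rw [vpos_side] at ha hb ⊢
        cases s <;> simp at ha hb ⊢ <;> omega
      have hcs := side c (by omega) (by omega)
      obtain ⟨e, he, hce⟩ := hs c hcs
      have t := nest hα.2 hab hce (by omega) (by omega)
      have hes := side e t.1 t.2
      have hne : vpos e ≠ vpos c := fun h => he (vpos_inj h)
      have hea : vpos e ≠ vpos a := by
        intro h
        have h := vpos_inj h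
        subst h
        have := hα.1 e b c hab (α.iseqv.symm hce)
        rcases this with h | h | h
        · rw [h] at h1; omega
        · exact he h
        · rw [h] at h3; omega
      exact ih c e hcs hes hce (by omega) (by omega)

/-- joining two vertices and relabelling -/
def jn {m : ℕ} (α : Dgm (m + 1)) (i j : Fin (m + 1)) : Dgm (m + 1) where
  r x y := x = y ∨ 
    ((x = Sum.inl (Fin.last m) ∨ x = Sum.inr (Fin.last m)) ∧ (y = Sum.inl (Fin.last m) ∨ y = Sum.inr (Fin.last m))) ∨
    (x ≠ Sum.inl (Fin.last m) ∧ x ≠ Sum.inr (Fin.last m) ∧ y ≠ Sum.inl (Fin.last m) ∧ y ≠ Sum.inr (Fin.last m) ∧ 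
      α.r (ph (Fin.last m) i (Fin.last m) j x) (ph (Fin.last m) i (Fin.last m) j y))
  iseqv := by
    have hs : ∀ a b, α.r a b → α.r b a := fun a b h => α.iseqv.symm h
    have ht : ∀ a b c, α.r a b → α.r b c → α.r a c := fun a b c h h' => α.iseqv.trans h h'
    refine ⟨fun _ => Or.inl rfl, ?_, ?_⟩
    · intro x y h
      grind
    · intro x y z h1 h2
      grind

theorem jn_mem {m : ℕ} {α : Dgm (m + 1)} (hα : α ∈ Mset (m + 1)) (i j : Fin (m + 1)) :
    jn α i j ∈ Mset (m + 1) := by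
  have hv : vpos (Sum.inr (Fin.last m) : PBV (m + 1)) = vpos (Sum.inl (Fin.last m) : PBV (m + 1)) + 1 := by
    simp [vpos]; omega
  constructor
  · rintro x y z (h | ⟨h1, h2⟩ | ⟨h1, h2, h3, h4, h5⟩) (h' | ⟨h1', h2'⟩ | ⟨h1', h2', h3', h4', h5'⟩)
    any_goals grind
    have := hα.1 _ _ _ h5 h5'
    simpa only [(ph_inj _ _ _ _).eq_iff] using this
  · rintro a b c d (rfl | ⟨h1, h2⟩ | ⟨h1, h2, h3, h4, h5⟩) (rfl | ⟨h1', h2'⟩ | ⟨h1', h2', h3', h4', h5'⟩) h7 h8 h9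
    any_goals omega
    · grind
    · grind
    · grind
    · exact hα.2 _ _ _ _ h5 h5' (ph_lt _ _ _ _ h1 h1' h2 h2' h7) (ph_lt _ _ _ _ h1' h3 h2' h4 h8)
        (ph_lt _ _ _ _ h3 h3' h4 h4' h9)

theorem jn_eq {m : ℕ} {α : Dgm (m + 1)} {i j : Fin (m + 1)}
    (hi : ∀ y, α.r (Sum.inl i) y → y = Sum.inl i) (hj : ∀ y, α.r (Sum.inr j) y → y = Sum.inr j) :
    α = pmul (tt i (Fin.last m)) (pmul (jn α i j) (tt (Fin.last m) j)) := by
  set L := Fin.last m with hL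
  have hne : ∀ x, x ≠ Sum.inl L → x ≠ Sum.inr L → ph L i L j x ≠ Sum.inl i ∧ ph L i L j x ≠ Sum.inr j := by
    intro x h1 h2
    constructor
    · intro h
      apply h1
      apply ph_inj L i L j
      rw [h]; simp [ph, gg_same]
    · intro h
      apply h2
      apply ph_inj L i L j
      rw [h]; simp [ph, gg_same]
  have hne' : ∀ x, x ≠ Sum.inl i → x ≠ Sum.inr j → ph i L j L x ≠ Sum.inl L ∧ ph i L j L x ≠ Sum.inr L := by
    intro x h1 h2
    constructor
    · intro h
      apply h1
      apply ph_inj i L j L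
      rw [h]; simp [ph, gg_same]
    · intro h
      apply h2
      apply ph_inj i L j L
      rw [h]; simp [ph, gg_same]
  apply eq_of_resp
  intro u v
  simp only [resp_pmul, resp_tt]
  constructor
  · intro hR
    refine ⟨fun a => if a = L then True else u (gg L i a), fun k => ?_,
      fun a => if a = L then True else v (gg L j a), ?_, fun k => ?_⟩
    · simp [gg_sA, Fin.succAbove_ne]
    · have e : ∀ x, x ≠ Sum.inl L → x ≠ Sum.inr L → 
        (Sum.elim (fun a => if a = L then True else u (gg L i a)) (fun a => if a = L then True else v (gg L j a)) x
          ↔ Sum.elim u v (ph L i L j x)) := by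
        rintro (x | x) h1 h2
        · have : x ≠ L := by simpa using h1
          simp [ph, this]
        · have : x ≠ L := by simpa using h2
          simp [ph, this]
      rintro x y (rfl | ⟨h1, h2⟩ | ⟨h1, h2, h3, h4, h5⟩)
      · exact Iff.rfl
      · rcases h1 with rfl | rfl <;> rcases h2 with rfl | rfl <;> simp [hL]
      · rw [e x h1 h2, e y h3 h4]
        exact hR _ _ h5
    · simp [gg_sA, Fin.succAbove_ne]
  · rintro ⟨w, h1, z, h2, h3⟩ x y hxy
    by_cases hx : x = y
    · rw [hx]
    · have hx1 : x ≠ Sum.inl i := by rintro rfl; exact hx (hi _ hxy).symm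
      have hx2 : x ≠ Sum.inr j := by rintro rfl; exact hx (hj _ hxy).symm
      have hy1 : y ≠ Sum.inl i := by rintro rfl; exact hx (hi _ (α.iseqv.symm hxy))
      have hy2 : y ≠ Sum.inr j := by rintro rfl; exact hx (hj _ (α.iseqv.symm hxy))
      have e : ∀ x, x ≠ Sum.inl i → x ≠ Sum.inr j → 
          (Sum.elim u v x ↔ Sum.elim w z (ph i L j L x)) := by
        rintro (x | x) g1 g2
        · have : x ≠ i := by simpa using g1
          obtain ⟨k, rfl⟩ := Fin.exists_succAbove_eq this
          simp [ph, gg_sA, h1]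
        · have : x ≠ j := by simpa using g2
          obtain ⟨k, rfl⟩ := Fin.exists_succAbove_eq this
          simp [ph, gg_sA, h3]
      rw [e x hx1 hx2, e y hy1 hy2]
      apply h2
      refine Or.inr (Or.inr ⟨(hne' x hx1 hx2).1, (hne' x hx1 hx2).2, (hne' y hy1 hy2).1, (hne' y hy1 hy2).2, ?_⟩)
      rw [ph_ph, ph_ph]
      exact hxy

theorem mu_jn {m : ℕ} {α : Dgm (m + 1)} {i j : Fin (m + 1)}
    (hi : ∀ y, α.r (Sum.inl i) y → y = Sum.inl i) (hj : ∀ y, α.r (Sum.inr j) y → y = Sum.inr j) :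
    mu (jn α i j) < mu α := by
  set L := Fin.last m with hL
  have hside : ∀ x : PBV (m + 1), (ph L i L j x).isLeft = x.isLeft := by
    rintro (x | x) <;> rfl
  have hinj := ph_inj L i L j
  have hnot : ∀ x ∈ NN (jn α i j), x ≠ Sum.inl L ∧ x ≠ Sum.inr L := by
    intro x hx
    constructor
    · rintro rfl
      have := hx (Sum.inr L) (Or.inr (Or.inl ⟨Or.inl rfl, Or.inr rfl⟩))
      simp at this
    · rintro rfl
      have := hx (Sum.inl L) (Or.inr (Or.inl ⟨Or.inr rfl, Or.inl rfl⟩))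
      simp at this
  have h1 : (NN (jn α i j)).ncard < (NN α).ncard := by
    rw [← Set.ncard_image_of_injective _ hinj]
    apply Set.ncard_lt_ncard _ (Set.toFinite _)
    rw [Set.ssubset_iff_of_subset]
    · refine ⟨Sum.inl i, ?_, ?_⟩
      · intro y hy
        rw [hi y hy]
      · rintro ⟨x, hx, hxe⟩
        apply (hnot x hx).1
        apply hinj
        rw [hxe]; simp [ph, gg_same]
    · rintro _ ⟨x, hx, rfl⟩ y hy
      obtain ⟨n1, n2⟩ := hnot x hx
      obtain ⟨y, rfl⟩ : ∃ y', ph L i L j y' = y := ⟨ph i L j L y, ph_ph i L j L y⟩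
      rw [hside, hside]
      by_cases h1 : y = Sum.inl L
      · subst h1
        exfalso
        apply n1
        apply hinj
        have e : ph L i L j (Sum.inl L) = Sum.inl i := by simp [ph, gg_same]
        rw [e] at hy ⊢
        exact hi _ (α.iseqv.symm hy)
      by_cases h2 : y = Sum.inr L
      · subst h2
        exfalso
        apply n2
        apply hinj
        have e : ph L i L j (Sum.inr L) = Sum.inr j := by simp [ph, gg_same]
        rw [e] at hy ⊢
        exact hj _ (α.iseqv.symm hy)
      exact hx y (Or.inr (Or.inr ⟨n1, n2, h1, h2, hy⟩))
  have h2 : (HH (jn α i j)).ncard ≤ (HH α).ncard := by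
    rw [← Set.ncard_image_of_injective _ hinj]
    apply Set.ncard_le_ncard _ (Set.toFinite _)
    rintro _ ⟨x, ⟨y, g1, g2, g3⟩, rfl⟩
    refine ⟨ph L i L j y, fun h => g1 (hinj h), ?_, by rw [hside, hside, g3]⟩
    rcases g2 with g2 | ⟨g2, g4⟩ | g2
    · exact absurd g2.symm g1
    · exfalso
      rcases g2 with rfl | rfl <;> rcases g4 with rfl | rfl <;> simp at g1 g3
    · exact g2.2.2.2.2
  unfold mu; omega

theorem mem_CC {m : ℕ} (N : ℕ) : ∀ α ∈ Mset (m + 1), mu α ≤ N → CC α := by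
  induction N using Nat.strong_induction_on with
  | _ N ih =>
  intro α hα hN
  have step : ∀ β ∈ Mset (m + 1), mu β < mu α → CC β := fun β hβ h => ih (mu β) (by omega) β hβ le_rfl
  have hone : CC (one (m + 1)) := MClo.base ⟨none, rfl⟩
  have hhk : ∀ k : Fin m, CC (hh k) := fun k => MClo.base ⟨some (Sum.inr k), rfl⟩
  -- hooks
  by_cases hH : ∃ s : Bool, (∀ x : PBV (m + 1), x.isLeft = s → ∃ y, y ≠ x ∧ α.r x y) ∧
      ∃ a b : PBV (m + 1), a.isLeft = s ∧ b.isLeft = s ∧ α.r a b ∧ a ≠ b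
  · obtain ⟨s, hs, a, b, ha, hb, hab, hne⟩ := hH
    have : ∃ a b : PBV (m + 1), a.isLeft = s ∧ b.isLeft = s ∧ α.r a b ∧ vpos b = vpos a + 1 := by
      rcases lt_or_gt_of_ne (fun h => hne (vpos_inj h)) with h | h
      · exact exists_adj hα s hs _ a b ha hb hab h le_rfl
      · exact exists_adj hα s hs _ b a hb ha (α.iseqv.symm hab) h le_rfl
    clear ha hb hab hne a b
    obtain ⟨a, b, ha, hb, hab, hv⟩ := this
    rcases a with a | a <;> rcases b with b | b
    · simp only [vpos] at hv
      obtain ⟨k, rfl, rfl⟩ : ∃ k : Fin m, a = k.castSucc ∧ b = k.succ :=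
        ⟨⟨a, by omega⟩, by ext; simp, by ext; simp [hv]⟩
      rw [hook_upper hα.1 k hab]
      refine MClo.mul (hhk k) (step _ (Mset_anti (rem_le _ _ _) hα) (mu_rem hα.1 hab ?_ rfl))
      simp [Fin.ext_iff]
    · simp at ha hb; rw [ha] at hb; simp at hb
    · simp at ha hb; rw [ha] at hb; simp at hb
    · simp only [vpos] at hv
      obtain ⟨k, rfl, rfl⟩ : ∃ k : Fin m, b = k.castSucc ∧ a = k.succ :=
        ⟨⟨b, by omega⟩, by ext; simp, by ext; simp; omega⟩
      have hab := α.iseqv.symm hab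
      rw [hook_lower hα.1 k hab]
      refine MClo.mul (step _ (Mset_anti (rem_le _ _ _) hα) (mu_rem hα.1 hab ?_ rfl)) (hhk k)
      simp [Fin.ext_iff]
  have hside : ∀ s : Bool, (∃ x : PBV (m + 1), x.isLeft = s ∧ ∀ y, α.r x y → y = x) ∨
      ∀ x : PBV (m + 1), x.isLeft = s → ∃ y, y.isLeft ≠ s ∧ α.r x y := by
    intro s
    by_cases h : ∃ x : PBV (m + 1), x.isLeft = s ∧ ∀ y, α.r x y → y = x
    · exact Or.inl h
    · right
      push Not at h
      intro x hx
      obtain ⟨y, hy, hne⟩ := h x hx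
      refine ⟨y, fun hys => hH ⟨s, fun x hx => ?_, x, y, hx, hys, hy, hne.symm⟩, hy⟩
      obtain ⟨y, hy, hne⟩ := h x hx
      exact ⟨y, hne, hy⟩
  have up : (∀ i, i ∈ domSet α) → CC α := by
    intro h
    rw [eq_one hα h]
    exact hone
  rcases hside true with ⟨x, hx, hx'⟩ | hU
  · rcases hside false with ⟨y, hy, hy'⟩ | hD
    · rcases x with i | i
      · rcases y with j | j
        · simp at hy
        · rw [jn_eq hx' hy']
          exact MClo.mul (CC_tt _ _) (MClo.mul (step _ (jn_mem hα _ _) (mu_jn hx' hy')) (CC_tt _ _))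
      · simp at hx
    · apply up
      have h1 : ∀ i, ∃ j, α.r (Sum.inr i) (Sum.inl j) := by
        intro i
        obtain ⟨y, h1, h2⟩ := hD (Sum.inr i) rfl
        rcases y with y | y
        · exact ⟨y, h2⟩
        · simp at h1
      choose f hf using h1
      have hinj : Function.Injective f := by
        intro a b hab
        have h1 := hf a
        have h2 := hf b
        rw [← hab] at h2
        have := hα.1 _ _ _ (α.iseqv.symm h1) (α.iseqv.symm h2)
        simpa using this
      intro i
      obtain ⟨j, rfl⟩ := Finite.surjective_of_injective hinj i
      exact ⟨j, α.iseqv.symm (hf j)⟩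
  · apply up
    intro i
    obtain ⟨y, h1, h2⟩ := hU (Sum.inl i) rfl
    rcases y with y | y
    · simp at h1
    · exact ⟨y, h2⟩

theorem gen_GG (m : ℕ) : genSet pmul (Set.range (GG (m := m))) = Mset (m + 1) := by
  ext α
  exact ⟨fun h => clo_mem h, fun h => mem_CC _ α h le_rfl⟩

theorem rank_succ (m : ℕ) : rnk (pmul (n := m + 1)) (Mset (m + 1)) = 2 * (m + 1) := by
  have hG : ∀ p, GG (m := m) p ∈ Mset (m + 1) := fun p => clo_mem (MClo.base ⟨p, rfl⟩)
  have hmem : (Finset.univ.image (GG (m := m))).card ∈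
      {k | ∃ X : Finset (Dgm (m + 1)), X.card = k ∧ genSet pmul ↑X = Mset (m + 1)} :=
    ⟨_, rfl, by rw [Finset.coe_image, Finset.coe_univ, Set.image_univ]; exact gen_GG m⟩
  apply le_antisymm
  · refine (Nat.sInf_le hmem).trans (Finset.card_image_le.trans ?_)
    simp
    omega
  · refine le_csInf ⟨_, hmem⟩ ?_
    rintro k ⟨X, rfl, hX⟩
    exact lower_bound hG X hX

theorem rank_zero : rnk (pmul (n := 0)) (Mset 0) = 1 := by
  have hsub : ∀ α β : Dgm 0, α = β := by
    intro α β
    apply Setoid.ext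
    rintro (x | x) <;> exact x.elim0
  apply le_antisymm
  · refine Nat.sInf_le ⟨{one 0}, by simp, ?_⟩
    ext α
    rw [hsub α (one 0)]
    exact ⟨fun _ => one_mem 0, fun _ => MClo.base (by simp)⟩
  · refine le_csInf ⟨1, {one 0}, by simp, ?_⟩ ?_
    · ext α
      rw [hsub α (one 0)]
      exact ⟨fun _ => one_mem 0, fun _ => MClo.base (by simp)⟩
    · rintro k ⟨X, rfl, hX⟩
      rw [Nat.one_le_iff_ne_zero]
      intro h
      rw [Finset.card_eq_zero] at h
      subst h
      have h1 : MClo pmul ((∅ : Finset (Dgm 0)) : Set (Dgm 0)) (one 0) := by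
        have := one_mem 0
        rw [← hX] at this
        exact this
      have h2 : ∀ a, MClo pmul ((∅ : Finset (Dgm 0)) : Set (Dgm 0)) a → False := by
        intro a ha
        induction ha with
        | base h => simp at h
        | mul _ _ ih _ => exact ih
      exact h2 _ h1

end MzR

/-- `rank(M_0) = 1`, and `rank(M_n) = 2n` for all `n ≥ 1`. -/
theorem rank_M :
    rnk (pmul (n := 0)) (Mset 0) = 1 ∧
    ∀ n : ℕ, 1 ≤ n → rnk (pmul (n := n)) (Mset n) = 2 * n := by
  refine ⟨MzR.rank_zero, ?_⟩
  intro n hn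
  obtain ⟨m, rfl⟩ : ∃ m, n = m + 1 := ⟨n - 1, by omega⟩
  exact MzR.rank_succ m
end
end

section
/- For n ≥ 2, the idempotent-generated subsemigroup of M_n satisfies ⟨E(M_n)⟩ = {id_A : A ⊆ {1,…,n} cosparse} ∪ {α ∈ M_n : dom(α) and codom(α) are both non-cosparse}, and rank(⟨E(M_n)⟩) = idrank(⟨E(M_n)⟩) = 3n − 2. -/
/-!
Partial Brauer diagrams on `n` points are formalized as set partitions
(equivalence relations, i.e. `Setoid`s) of the vertex set
`{1,…,n} ∪ {1',…,n'}`, encoded as `Fin n ⊕ Fin n`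
(`Sum.inl i` is the upper vertex `i`, `Sum.inr i` is the lower vertex `i'`),
all of whose blocks have size at most 2.  The product of two diagrams is
defined via connectivity (paths) in the product graph, and the involution `*`
by interchanging the two rows of vertices.
-/

noncomputable section

open scoped Classical

open Dgm
namespace Dgm
theorem dext {V : Type*} {α β : Setoid V} (h : ∀ x y, α.r x y ↔ β.r x y) : α = β :=
  Setoid.ext h

theorem RGen.lift {V W : Type*} {r : V → V → Prop} {f : V → W} {s : W → W → Prop}
    (hf : ∀ x y, r x y → RGen s (f x) (f y)) {x y : V} (h : RGen r x y) : RGen s (f x) (f y) := by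
  induction h with
  | rel h => exact hf _ _ h
  | refl x => exact RGen.refl _
  | symm _ ih => exact ih.symm
  | trans _ _ ih1 ih2 => exact ih1.trans ih2

theorem RGen.lab {V W : Type*} {r : V → V → Prop} {f : V → W}
    (hf : ∀ x y, r x y → f x = f y) {x y : V} (h : RGen r x y) : f x = f y := by
  induction h with
  | rel h => exact hf _ _ h
  | refl x => rfl
  | symm _ ih => exact ih.symm
  | trans _ _ ih1 ih2 => exact ih1.trans ih2

theorem srefl {V : Type*} (α : Setoid V) : ∀ x, α.r x x := α.iseqv.refl
theorem ssymm {V : Type*} (α : Setoid V) : ∀ x y, α.r x y → α.r y x := fun _ _ h => α.iseqv.symm h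
theorem strans {V : Type*} (α : Setoid V) : ∀ x y z, α.r x y → α.r y z → α.r x z :=
  fun _ _ _ h h' => α.iseqv.trans h h'

section abs
variable {V : Type*}

def op1 (p : V) (α : Setoid V) : Setoid V where
  r x y := x = y ∨ (x ≠ p ∧ y ≠ p ∧ α.r x y)
  iseqv := by
    have h1 := srefl α
    have h2 := ssymm α
    have h3 := strans α
    exact ⟨by grind, by grind, by grind⟩

def op2 (p q : V) (α : Setoid V) : Setoid V where
  r x y := x = y ∨ (x = p ∧ y = q) ∨ (x = q ∧ y = p) ∨
    (x ≠ p ∧ y ≠ p ∧ x ≠ q ∧ y ≠ q ∧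
      (α.r x y ∨ (α.r x p ∧ α.r y q) ∨ (α.r x q ∧ α.r y p)))
  iseqv := by
    have h1 := srefl α
    have h2 := ssymm α
    have h3 := strans α
    exact ⟨by grind, by grind, by grind⟩

def op3 (p m q : V) (α : Setoid V) : Setoid V where
  r x y := x = y ∨ (x ≠ m ∧ y ≠ m ∧ (op2 p q α).r x y)
  iseqv := by
    have h1 := srefl (op2 p q α)
    have h2 := ssymm (op2 p q α)
    have h3 := strans (op2 p q α)
    exact ⟨by grind, by grind, by grind⟩

theorem op1_r (p : V) (α : Setoid V) (x y : V) :
    (op1 p α).r x y ↔ x = y ∨ (x ≠ p ∧ y ≠ p ∧ α.r x y) := Iff.rfl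

theorem op2_r (p q : V) (α : Setoid V) (x y : V) :
    (op2 p q α).r x y ↔ x = y ∨ (x = p ∧ y = q) ∨ (x = q ∧ y = p) ∨
    (x ≠ p ∧ y ≠ p ∧ x ≠ q ∧ y ≠ q ∧
      (α.r x y ∨ (α.r x p ∧ α.r y q) ∨ (α.r x q ∧ α.r y p))) := Iff.rfl

theorem op3_r (p m q : V) (α : Setoid V) (x y : V) :
    (op3 p m q α).r x y ↔ x = y ∨ (x ≠ m ∧ y ≠ m ∧ (op2 p q α).r x y) := Iff.rfl

theorem comap_r {W : Type*} (f : W → V) (α : Setoid V) (x y : W) :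
    (Setoid.comap f α).r x y ↔ α.r (f x) (f y) := Iff.rfl

/-- `p` is a singleton block. -/
def Sing (α : Setoid V) (p : V) : Prop := ∀ y, α.r p y → y = p

theorem sing' {α : Setoid V} {p : V} (h : Sing α p) (y) (hy : α.r y p) : y = p :=
  h y (α.iseqv.symm hy)

theorem add_r (α : Setoid V) (p m : V) (hp : Sing α p) (hm : Sing α m) (x y : V) :
    (op2 p m α).r x y ↔ α.r x y ∨ (x = p ∧ y = m) ∨ (x = m ∧ y = p) := by
  have e1 := srefl α
  have hm' := sing' hm
  have hp' := sing' hp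
  unfold Sing at hm hp
  rw [op2_r]
  grind

theorem op3_eq (α : Setoid V) (p l m : V) (h1 : p ≠ l) (h2 : m ≠ l) (hp : Sing α p)
    (hm : Sing α m) (hl : Sing α l) : op3 p l m α = op2 p m α := by
  apply dext
  intro x y
  have e1 := srefl α
  have hl' := sing' hl
  unfold Sing at hl
  rw [op3_r, add_r α p m hp hm]
  grind

theorem zig (β : Setoid V) (p m q : V) (h1 : p ≠ m) (h2 : p ≠ q) (h3 : m ≠ q)
    (hpm : β.r p m) (hp : ∀ y, β.r p y → y = p ∨ y = m) :
    op2 m q β = Setoid.comap (Equiv.swap p q) β := by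
  apply dext
  intro x y
  have e1 := srefl β
  have e2 := ssymm β
  have e3 := strans β
  have hp' : ∀ y, β.r y p → y = p ∨ y = m := fun y h => hp y (e2 _ _ h)
  have hm : ∀ y, β.r m y → y = p ∨ y = m := fun y h => hp y (e3 _ _ _ hpm h)
  have hm' : ∀ y, β.r y m → y = p ∨ y = m := fun y h => hm y (e2 _ _ h)
  have hmp := e2 _ _ hpm
  rw [op2_r, comap_r (Equiv.swap p q) β x y]
  have sp : Equiv.swap p q p = q := Equiv.swap_apply_left _ _
  have sq : Equiv.swap p q q = p := Equiv.swap_apply_right _ _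
  have so : ∀ z, z ≠ p → z ≠ q → Equiv.swap p q z = z := fun z => Equiv.swap_apply_of_ne_of_ne
  generalize Equiv.swap p q = s at *
  by_cases xp : x = p
  · subst xp
    by_cases yp : y = x
    · grind
    by_cases yq : y = q <;> grind
  by_cases xq : x = q
  · by_cases yp : y = p
    · grind
    by_cases yq : y = q <;> grind
  rw [so x xp xq]
  by_cases yp : y = p
  · grind
  by_cases yq : y = q
  · grind
  rw [so y yp yq]
  grind

theorem Saux (α : Setoid V) (p m q : V) (h1 : p ≠ m) (h2 : p ≠ q) (h3 : m ≠ q)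
    (hm : Sing α m) (hq : Sing α q) :
    op1 m (op2 m q (op2 p m (Setoid.comap (Equiv.swap p q) α))) = α := by
  have sp : Equiv.swap p q p = q := Equiv.swap_apply_left _ _
  have sm : Equiv.swap p q m = m := Equiv.swap_apply_of_ne_of_ne h1.symm h3
  have sp' : Sing (Setoid.comap (Equiv.swap p q) α) p := by
    intro y hy
    rw [comap_r, sp] at hy
    have := hq _ hy
    exact (Equiv.swap p q).injective (this.trans sp.symm)
  have sm' : Sing (Setoid.comap (Equiv.swap p q) α) m := by
    intro y hy
    rw [comap_r, sm] at hy
    have := hm _ hy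
    exact (Equiv.swap p q).injective (this.trans sm.symm)
  rw [zig _ p m q h1 h2 h3]
  · apply dext
    intro x y
    rw [op1_r, comap_r, add_r _ _ _ sp' sm', comap_r, Equiv.swap_apply_self, Equiv.swap_apply_self]
    have hx : Equiv.swap p q x = m → x = m := by
      intro h; rw [← Equiv.swap_apply_self p q x, h, sm]
    have hy : Equiv.swap p q y = m → y = m := by
      intro h; rw [← Equiv.swap_apply_self p q y, h, sm]
    have e1 := srefl α
    have hm' := sing' hm
    unfold Sing at hm
    grind
  · rw [add_r _ _ _ sp' sm']; simp
  · intro y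
    rw [add_r _ _ _ sp' sm']
    rintro (h | h | h)
    · exact Or.inl (sp' y h)
    · exact Or.inr h.2
    · exact Or.inl h.2

theorem S2abs (α : Setoid V) (p m q : V) (h1 : p ≠ m) (h2 : p ≠ q) (h3 : m ≠ q)
    (hm : Sing α m) (hq : Sing α q) :
    op1 m (op2 m q (op2 p m (Setoid.comap (Equiv.swap p q) α))) = α :=
  Saux α p m q h1 h2 h3 hm hq

theorem sing_comap {W : Type*} (α : Setoid V) (f : W ≃ V) (p : W) (h : Sing α (f p)) :
    Sing (Setoid.comap f α) p := fun _ hy => f.injective (h _ hy)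

theorem S3abs (α : Setoid V) (p l m q : V) (h1 : p ≠ m) (h2 : p ≠ q) (h3 : m ≠ q)
    (h4 : p ≠ l) (h5 : l ≠ m) (h6 : l ≠ q)
    (hl : Sing α l) (hm : Sing α m) (hq : Sing α q) :
    op1 m (op2 m q (op3 p l m (Setoid.comap (Equiv.swap p q) α))) = α := by
  rw [op3_eq _ _ _ _ h4 h5.symm]
  · exact Saux α p m q h1 h2 h3 hm hq
  · exact sing_comap _ _ _ (by rwa [Equiv.swap_apply_left])
  · exact sing_comap _ _ _ (by rwa [Equiv.swap_apply_of_ne_of_ne h1.symm h3])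
  · exact sing_comap _ _ _ (by rwa [Equiv.swap_apply_of_ne_of_ne h4.symm h6])

/-- hook killing, distance one -/
theorem K2abs (α : Setoid V) (p q : V) (h : p ≠ q) (hpq : α.r p q)
    (hp : ∀ y, α.r p y → y = p ∨ y = q) : op2 p q (op1 q α) = α := by
  have e1 := srefl α
  have e2 := ssymm α
  have e3 := strans α
  have sq : Sing (op1 q α) q := by intro y; rw [op1_r]; grind
  have sp : Sing (op1 q α) p := by intro y; rw [op1_r]; grind
  apply dext
  intro x y
  rw [add_r _ _ _ sp sq, op1_r]
  have h1 := hp x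
  have h2 := hp y
  grind

theorem K3abs (α : Setoid V) (p l q : V) (h : p ≠ q) (hpl : p ≠ l) (hlq : l ≠ q) (hpq : α.r p q)
    (hp : ∀ y, α.r p y → y = p ∨ y = q) (hl : Sing α l) : op3 p l q (op1 q α) = α := by
  have e1 := srefl α
  have e2 := ssymm α
  have e3 := strans α
  have sq : Sing (op1 q α) q := by intro y; rw [op1_r]; grind
  have sp : Sing (op1 q α) p := by intro y; rw [op1_r]; grind
  have sl : Sing (op1 q α) l := by intro y; have := hl y; rw [op1_r]; grind
  rw [op3_eq _ _ _ _ hpl hlq.symm sp sq sl, K2abs α p q h hpq hp]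
end abs
end Dgm

namespace Dgm
variable {n : ℕ}

theorem pmul_r (α β : Dgm n) (x y : PBV n) :
    (pmul α β).r x y ↔ RGen (prodEdges α β) (topBot x) (topBot y) := Iff.rfl

theorem pstar_r (α : Dgm n) (x y : PBV n) :
    (pstar α).r x y ↔ α.r (swapUD x) (swapUD y) := Iff.rfl

theorem swapUD_swapUD (x : PBV n) : swapUD (swapUD x) = x := by cases x <;> rfl

theorem pstar_pstar (α : Dgm n) : pstar (pstar α) = α := by
  apply dext; intro x y
  rw [pstar_r, pstar_r, swapUD_swapUD, swapUD_swapUD]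

theorem edge_top {α β : Dgm n} {a b : PBV n} (h : α.r a b) :
    RGen (prodEdges α β) (topMid a) (topMid b) := RGen.rel (Or.inl ⟨a, b, h, rfl, rfl⟩)

theorem edge_bot {α β : Dgm n} {a b : PBV n} (h : β.r a b) :
    RGen (prodEdges α β) (midBot a) (midBot b) := RGen.rel (Or.inr ⟨a, b, h, rfl, rfl⟩)

/-- labelling principle -/
theorem pmul_lab {W : Type*} {α β : Dgm n} (c : V3 n → W)
    (h1 : ∀ a b, α.r a b → c (topMid a) = c (topMid b))
    (h2 : ∀ a b, β.r a b → c (midBot a) = c (midBot b)) {z w : V3 n}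
    (h : RGen (prodEdges α β) z w) : c z = c w := by
  refine RGen.lab ?_ h
  rintro x y (⟨a, b, hab, rfl, rfl⟩ | ⟨a, b, hab, rfl, rfl⟩)
  · exact h1 _ _ hab
  · exact h2 _ _ hab

def flip3 : V3 n → V3 n
  | Sum.inl i => Sum.inr (Sum.inr i)
  | Sum.inr (Sum.inl i) => Sum.inr (Sum.inl i)
  | Sum.inr (Sum.inr i) => Sum.inl i

theorem flip_top (x : PBV n) : flip3 (topMid x) = midBot (swapUD x) := by cases x <;> rfl
theorem flip_mid (x : PBV n) : flip3 (midBot x) = topMid (swapUD x) := by cases x <;> rfl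
theorem flip_tb (x : PBV n) : flip3 (topBot x) = topBot (swapUD x) := by cases x <;> rfl

theorem star_aux {α β : Dgm n} {z w : V3 n} (h : RGen (prodEdges α β) z w) :
    RGen (prodEdges (pstar β) (pstar α)) (flip3 z) (flip3 w) := by
  refine RGen.lift ?_ h
  rintro x y (⟨a, b, hab, rfl, rfl⟩ | ⟨a, b, hab, rfl, rfl⟩)
  · rw [flip_top, flip_top]
    apply edge_bot
    rw [pstar_r, swapUD_swapUD, swapUD_swapUD]; exact hab
  · rw [flip_mid, flip_mid]
    apply edge_top
    rw [pstar_r, swapUD_swapUD, swapUD_swapUD]; exact hab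

theorem pstar_pmul (α β : Dgm n) : pstar (pmul α β) = pmul (pstar β) (pstar α) := by
  apply dext; intro x y
  rw [pstar_r, pmul_r, pmul_r]
  constructor
  · intro h
    have := star_aux h
    rwa [flip_tb, flip_tb, swapUD_swapUD, swapUD_swapUD] at this
  · intro h
    have := star_aux h
    rwa [flip_tb, flip_tb, pstar_pstar, pstar_pstar] at this

/-! ### associativity -/

/-- four rows -/
abbrev V4 (n : ℕ) := Fin n ⊕ (Fin n ⊕ (Fin n ⊕ Fin n))

def r01 : PBV n → V4 n
  | Sum.inl i => Sum.inl i
  | Sum.inr i => Sum.inr (Sum.inl i)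
def r12 : PBV n → V4 n
  | Sum.inl i => Sum.inr (Sum.inl i)
  | Sum.inr i => Sum.inr (Sum.inr (Sum.inl i))
def r23 : PBV n → V4 n
  | Sum.inl i => Sum.inr (Sum.inr (Sum.inl i))
  | Sum.inr i => Sum.inr (Sum.inr (Sum.inr i))
def r03 : PBV n → V4 n
  | Sum.inl i => Sum.inl i
  | Sum.inr i => Sum.inr (Sum.inr (Sum.inr i))

def E4 (α β γ : Dgm n) (x y : V4 n) : Prop :=
  (∃ a b, α.r a b ∧ x = r01 a ∧ y = r01 b) ∨ (∃ a b, β.r a b ∧ x = r12 a ∧ y = r12 b) ∨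
  (∃ a b, γ.r a b ∧ x = r23 a ∧ y = r23 b)

/-- rows 0,1,2 -/
def j012 : V3 n → V4 n
  | Sum.inl i => Sum.inl i
  | Sum.inr (Sum.inl i) => Sum.inr (Sum.inl i)
  | Sum.inr (Sum.inr i) => Sum.inr (Sum.inr (Sum.inl i))
/-- rows 0,2,3 -/
def j023 : V3 n → V4 n
  | Sum.inl i => Sum.inl i
  | Sum.inr (Sum.inl i) => Sum.inr (Sum.inr (Sum.inl i))
  | Sum.inr (Sum.inr i) => Sum.inr (Sum.inr (Sum.inr i))

def c4 (α β γ : Dgm n) : V4 n → Set (V3 n)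
  | Sum.inl i => {w | RGen (prodEdges (pmul α β) γ) (Sum.inl i) w}
  | Sum.inr (Sum.inl i) => {w | ∃ x : PBV n, RGen (prodEdges α β) (Sum.inr (Sum.inl i)) (topBot x) ∧
      RGen (prodEdges (pmul α β) γ) (topMid x) w}
  | Sum.inr (Sum.inr (Sum.inl i)) => {w | RGen (prodEdges (pmul α β) γ) (Sum.inr (Sum.inl i)) w}
  | Sum.inr (Sum.inr (Sum.inr i)) => {w | RGen (prodEdges (pmul α β) γ) (Sum.inr (Sum.inr i)) w}

theorem c4_012 (α β γ : Dgm n) (z : V3 n) :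
    c4 α β γ (j012 z) = {w | ∃ x : PBV n, RGen (prodEdges α β) z (topBot x) ∧
      RGen (prodEdges (pmul α β) γ) (topMid x) w} := by
  have key : ∀ x : PBV n, {w | RGen (prodEdges (pmul α β) γ) (topMid x) w} =
      {w | ∃ y : PBV n, RGen (prodEdges α β) (topBot x) (topBot y) ∧
      RGen (prodEdges (pmul α β) γ) (topMid y) w} := by
    intro x
    ext w
    constructor
    · intro h; exact ⟨x, RGen.refl _, h⟩
    · rintro ⟨y, h1, h2⟩
      exact (edge_top (α := pmul α β) (a := x) (b := y) h1).trans h2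
  rcases z with i | i | i
  · exact key (Sum.inl i)
  · rfl
  · exact key (Sum.inr i)

theorem c4_023 (α β γ : Dgm n) (z : V3 n) :
    c4 α β γ (j023 z) = {w | RGen (prodEdges (pmul α β) γ) z w} := by
  rcases z with i | i | i <;> rfl

theorem c4_edge (α β γ : Dgm n) (x y : V4 n) (h : E4 α β γ x y) : c4 α β γ x = c4 α β γ y := by
  have k1 : ∀ z w : V3 n, RGen (prodEdges α β) z w → c4 α β γ (j012 z) = c4 α β γ (j012 w) := by
    intro z w hzw
    rw [c4_012, c4_012]
    ext v
    constructor
    · rintro ⟨x, h1, h2⟩; exact ⟨x, hzw.symm.trans h1, h2⟩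
    · rintro ⟨x, h1, h2⟩; exact ⟨x, hzw.trans h1, h2⟩
  have k2 : ∀ z w : V3 n, RGen (prodEdges (pmul α β) γ) z w →
      c4 α β γ (j023 z) = c4 α β γ (j023 w) := by
    intro z w hzw
    rw [c4_023, c4_023]
    ext v
    exact ⟨fun h => hzw.symm.trans h, fun h => hzw.trans h⟩
  rcases h with ⟨a, b, hab, rfl, rfl⟩ | ⟨a, b, hab, rfl, rfl⟩ | ⟨a, b, hab, rfl, rfl⟩
  · have := k1 _ _ (edge_top hab)
    rcases a with a | a <;> rcases b with b | b <;> exact this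
  · have := k1 _ _ (edge_bot hab)
    rcases a with a | a <;> rcases b with b | b <;> exact this
  · have := k2 _ _ (edge_bot hab)
    rcases a with a | a <;> rcases b with b | b <;> exact this

theorem pmul_left4 (α β γ : Dgm n) (x y : PBV n) :
    (pmul (pmul α β) γ).r x y ↔ RGen (E4 α β γ) (r03 x) (r03 y) := by
  rw [pmul_r]
  have e : ∀ x : PBV n, r03 x = j023 (topBot x) := by rintro (x | x) <;> rfl
  rw [e, e]
  constructor
  · intro h
    refine RGen.lift (f := j023) ?_ h
    rintro z w (⟨a, b, hab, rfl, rfl⟩ | ⟨a, b, hab, rfl, rfl⟩)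
    · have e2 : ∀ x : PBV n, j023 (topMid x) = j012 (topBot x) := by rintro (x | x) <;> rfl
      rw [e2, e2]
      refine RGen.lift (f := j012) ?_ hab
      rintro z w (⟨a, b, hab, rfl, rfl⟩ | ⟨a, b, hab, rfl, rfl⟩)
      · apply RGen.rel; left
        exact ⟨a, b, hab, by cases a <;> rfl, by cases b <;> rfl⟩
      · apply RGen.rel; right; left
        exact ⟨a, b, hab, by cases a <;> rfl, by cases b <;> rfl⟩
    · apply RGen.rel; right; right
      exact ⟨a, b, hab, by cases a <;> rfl, by cases b <;> rfl⟩
  · intro h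
    have := RGen.lab (c4_edge α β γ) h
    rw [c4_023, c4_023] at this
    have h2 : topBot y ∈ {w | RGen (prodEdges (pmul α β) γ) (topBot y) w} := RGen.refl _
    rw [← this] at h2
    exact h2

def flip4 : V4 n → V4 n
  | Sum.inl i => Sum.inr (Sum.inr (Sum.inr i))
  | Sum.inr (Sum.inl i) => Sum.inr (Sum.inr (Sum.inl i))
  | Sum.inr (Sum.inr (Sum.inl i)) => Sum.inr (Sum.inl i)
  | Sum.inr (Sum.inr (Sum.inr i)) => Sum.inl i

theorem star4 {α β γ : Dgm n} {z w : V4 n} (h : RGen (E4 α β γ) z w) :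
    RGen (E4 (pstar γ) (pstar β) (pstar α)) (flip4 z) (flip4 w) := by
  refine RGen.lift ?_ h
  rintro x y (⟨a, b, hab, rfl, rfl⟩ | ⟨a, b, hab, rfl, rfl⟩ | ⟨a, b, hab, rfl, rfl⟩)
  · apply RGen.rel; right; right
    exact ⟨swapUD a, swapUD b, by rwa [pstar_r, swapUD_swapUD, swapUD_swapUD],
      by cases a <;> rfl, by cases b <;> rfl⟩
  · apply RGen.rel; right; left
    exact ⟨swapUD a, swapUD b, by rwa [pstar_r, swapUD_swapUD, swapUD_swapUD],
      by cases a <;> rfl, by cases b <;> rfl⟩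
  · apply RGen.rel; left
    exact ⟨swapUD a, swapUD b, by rwa [pstar_r, swapUD_swapUD, swapUD_swapUD],
      by cases a <;> rfl, by cases b <;> rfl⟩

theorem pmul_assoc (α β γ : Dgm n) : pmul (pmul α β) γ = pmul α (pmul β γ) := by
  apply dext; intro x y
  have e : pmul α (pmul β γ) = pstar (pmul (pmul (pstar γ) (pstar β)) (pstar α)) := by
    rw [pstar_pmul, pstar_pmul, pstar_pstar, pstar_pstar, pstar_pstar]
  have f : ∀ x : PBV n, flip4 (r03 x) = r03 (swapUD x) := by rintro (x | x) <;> rfl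
  rw [e, pstar_r, pmul_left4, pmul_left4]
  constructor
  · intro h
    have := star4 h
    rwa [f, f] at this
  · intro h
    have := star4 h
    rwa [f, f, pstar_pstar, pstar_pstar, pstar_pstar, swapUD_swapUD, swapUD_swapUD] at this

end Dgm

namespace Dgm
variable {n : ℕ}

def etaLab (i k : Fin n) : PBV n → ℕ × Fin n
  | Sum.inl a => if i ≤ a ∧ a ≤ k then (0, if a = k then i else a) else (2, a)
  | Sum.inr a => if i ≤ a ∧ a ≤ k then (1, if a = k then i else a) else (2, a)

/-- The generators: hook `{i,k}` above and below, singletons strictly between. -/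
def eta (i k : Fin n) : Dgm n := Setoid.ker (etaLab i k)

theorem eta_r (i k : Fin n) (x y : PBV n) : (eta i k).r x y ↔ etaLab i k x = etaLab i k y := Iff.rfl

theorem eta_star (i k : Fin n) : pstar (eta i k) = eta i k := by
  apply dext; intro x y
  rw [pstar_r, eta_r, eta_r]
  rcases x with x | x <;> rcases y with y | y <;> simp only [swapUD, etaLab] <;> grind

/-- lower vertices in the interval `[i,k]` -/
def LowI (i k : Fin n) : PBV n → Prop
  | Sum.inl _ => False
  | Sum.inr a => i ≤ a ∧ a ≤ k

/-- upper vertices in the interval `[i,k]` -/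
def UpI (i k : Fin n) : PBV n → Prop
  | Sum.inl a => i ≤ a ∧ a ≤ k
  | Sum.inr _ => False

def plusS (α : Dgm n) (p q : PBV n) : Dgm n where
  r x y := α.r x y ∨ (α.r x p ∧ α.r y q) ∨ (α.r x q ∧ α.r y p)
  iseqv := by
    have h1 := srefl α
    have h2 := ssymm α
    have h3 := strans α
    exact ⟨by grind, by grind, by grind⟩

theorem plusS_r (α : Dgm n) (p q x y : PBV n) : (plusS α p q).r x y ↔
    α.r x y ∨ (α.r x p ∧ α.r y q) ∨ (α.r x q ∧ α.r y p) := Iff.rfl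

def rLab (α : Dgm n) (i k : Fin n) : V3 n → Quotient (plusS α (Sum.inr i) (Sum.inr k)) ⊕ Fin n
  | Sum.inl a => Sum.inl (Quotient.mk _ (Sum.inl a))
  | Sum.inr (Sum.inl a) => Sum.inl (Quotient.mk _ (Sum.inr a))
  | Sum.inr (Sum.inr a) => if i ≤ a ∧ a ≤ k then Sum.inr (if a = k then i else a)
      else Sum.inl (Quotient.mk _ (Sum.inr a))

/-- right multiplication by a generator -/
theorem pmul_eta_r (α : Dgm n) (i k : Fin n) (hik : i ≤ k) (x y : PBV n) :
    (pmul α (eta i k)).r x y ↔ x = y ∨ (x = Sum.inr i ∧ y = Sum.inr k) ∨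
      (x = Sum.inr k ∧ y = Sum.inr i) ∨ (¬ LowI i k x ∧ ¬ LowI i k y ∧
        (plusS α (Sum.inr i) (Sum.inr k)).r x y) := by
  rw [pmul_r]
  constructor
  · intro h
    have hl := pmul_lab (rLab α i k) ?_ ?_ h
    · rcases x with x | x <;> rcases y with y | y <;> simp only [topBot, rLab, LowI] at hl ⊢
      · right; right; right
        refine ⟨not_false, not_false, ?_⟩
        exact Quotient.exact (Sum.inl.inj hl)
      · split_ifs at hl with h1
        right; right; right
        refine ⟨not_false, h1, ?_⟩
        exact Quotient.exact (Sum.inl.inj hl)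
      · split_ifs at hl with h1
        right; right; right
        refine ⟨h1, not_false, ?_⟩
        exact Quotient.exact (Sum.inl.inj hl)
      · by_cases h1 : i ≤ x ∧ x ≤ k <;> by_cases h2 : i ≤ y ∧ y ≤ k
        · rw [if_pos h1, if_pos h2] at hl
          have := Sum.inr.inj hl
          grind
        · rw [if_pos h1, if_neg h2] at hl; cases hl
        · rw [if_neg h1, if_pos h2] at hl; cases hl
        · rw [if_neg h1, if_neg h2] at hl
          right; right; right
          exact ⟨h1, h2, Quotient.exact (Sum.inl.inj hl)⟩
    · have e : ∀ a : PBV n, rLab α i k (topMid a) = Sum.inl (Quotient.mk _ a) := by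
        rintro (a | a) <;> rfl
      intro a b hab
      rw [e, e]
      congr 1
      exact Quotient.sound (Or.inl hab)
    · have hik' : (Quotient.mk (plusS α (Sum.inr i) (Sum.inr k)) (Sum.inr i)) =
          Quotient.mk (plusS α (Sum.inr i) (Sum.inr k)) (Sum.inr k) :=
        Quotient.sound (Or.inr (Or.inl ⟨srefl α _, srefl α _⟩))
      intro a b hab
      rw [eta_r] at hab
      rcases a with a | a <;> rcases b with b | b <;> simp only [midBot, rLab, etaLab] at hab ⊢ <;>
        grind
  · have step : ∀ x : PBV n, ¬ LowI i k x →
        RGen (prodEdges α (eta i k)) (topBot x) (topMid x) := by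
      rintro (x | x) hx
      · exact RGen.refl _
      · have : (eta i k).r (Sum.inr x) (Sum.inl x) := by
          rw [eta_r]; simp only [etaLab, LowI] at hx ⊢; rw [if_neg hx, if_neg hx]
        exact edge_bot this
    have hu : (eta i k).r (Sum.inl i) (Sum.inl k) := by
      rw [eta_r]; simp only [etaLab]; grind
    have hd : (eta i k).r (Sum.inr i) (Sum.inr k) := by
      rw [eta_r]; simp only [etaLab]; grind
    have mid : RGen (prodEdges α (eta i k)) (topMid (Sum.inr i)) (topMid (Sum.inr k)) :=
      edge_bot hu
    have bot : RGen (prodEdges α (eta i k)) (topBot (Sum.inr i)) (topBot (Sum.inr k)) :=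
      edge_bot hd
    rintro (rfl | ⟨rfl, rfl⟩ | ⟨rfl, rfl⟩ | ⟨hx, hy, h⟩)
    · exact RGen.refl _
    · exact bot
    · exact bot.symm
    · refine (step x hx).trans (RGen.trans ?_ (step y hy).symm)
      rcases h with h | ⟨h1, h2⟩ | ⟨h1, h2⟩
      · exact edge_top h
      · exact (edge_top h1).trans (mid.trans (edge_top h2).symm)
      · exact (edge_top h1).trans (mid.symm.trans (edge_top h2).symm)

theorem swapUD_eq (x y : PBV n) : swapUD x = y ↔ x = swapUD y := by
  constructor
  · rintro rfl; rw [swapUD_swapUD]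
  · rintro rfl; rw [swapUD_swapUD]

/-- left multiplication by a generator -/
theorem eta_pmul_r (α : Dgm n) (i k : Fin n) (hik : i ≤ k) (x y : PBV n) :
    (pmul (eta i k) α).r x y ↔ x = y ∨ (x = Sum.inl i ∧ y = Sum.inl k) ∨
      (x = Sum.inl k ∧ y = Sum.inl i) ∨ (¬ UpI i k x ∧ ¬ UpI i k y ∧
        (plusS α (Sum.inl i) (Sum.inl k)).r x y) := by
  have e : pmul (eta i k) α = pstar (pmul (pstar α) (eta i k)) := by
    rw [pstar_pmul, pstar_pstar, eta_star]
  have l : ∀ x : PBV n, LowI i k (swapUD x) ↔ UpI i k x := by rintro (x | x) <;> rfl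
  rw [e, pstar_r, pmul_eta_r _ _ _ hik, l, l, plusS_r, plusS_r, pstar_r, pstar_r, pstar_r, pstar_r,
    pstar_r]
  simp only [swapUD_eq, swapUD_swapUD]
  rfl

theorem eta_op1 (i : Fin n) (α : Dgm n) : pmul (eta i i) α = op1 (Sum.inl i) α := by
  apply dext; intro x y
  rw [eta_pmul_r _ _ _ le_rfl, op1_r, plusS_r]
  have l : ∀ x : PBV n, UpI i i x ↔ x = Sum.inl i := by
    rintro (x | x) <;> simp [UpI]
    omega
  have h2 := ssymm α
  have h3 := strans α
  rw [l, l]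
  grind

theorem eta_op2 (i k : Fin n) (h : (k : ℕ) = i + 1) (α : Dgm n) :
    pmul (eta i k) α = op2 (Sum.inl i) (Sum.inl k) α := by
  apply dext; intro x y
  have l : ∀ x : PBV n, UpI i k x ↔ x = Sum.inl i ∨ x = Sum.inl k := by
    rintro (x | x) <;> simp [UpI]
    omega
  rw [eta_pmul_r _ _ _ (by rw [Fin.le_def]; omega), op2_r, plusS_r, l, l]
  grind

theorem eta_op3 (i j k : Fin n) (h : (j : ℕ) = i + 1) (h' : (k : ℕ) = j + 1) (α : Dgm n) :
    pmul (eta i k) α = op3 (Sum.inl i) (Sum.inl j) (Sum.inl k) α := by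
  apply dext; intro x y
  have l : ∀ x : PBV n, UpI i k x ↔ x = Sum.inl i ∨ x = Sum.inl j ∨ x = Sum.inl k := by
    rintro (x | x) <;> simp [UpI]
    omega
  have n1 : (Sum.inl i : PBV n) ≠ Sum.inl j := by simp; omega
  have n2 : (Sum.inl k : PBV n) ≠ Sum.inl j := by simp; omega
  rw [eta_pmul_r _ _ _ (by rw [Fin.le_def]; omega), op3_r, op2_r, plusS_r, l, l]
  grind

theorem op2_comm {V : Type*} (p q : V) (α : Setoid V) : op2 p q α = op2 q p α := by
  apply dext; intro x y; rw [op2_r, op2_r]; grind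

theorem op3_comm {V : Type*} (p m q : V) (α : Setoid V) : op3 p m q α = op3 q m p α := by
  apply dext; intro x y; rw [op3_r, op3_r, op2_comm]

/-! ### partial identities -/

theorem idd_r (A : Set (Fin n)) (x y : PBV n) : (idd A).r x y ↔ x = y ∨
    ∃ a ∈ A, (x = Sum.inl a ∧ y = Sum.inr a) ∨ (x = Sum.inr a ∧ y = Sum.inl a) := by
  unfold idd
  rw [Setoid.ker_def]
  rcases x with x | x <;> rcases y with y | y <;> simp
  · grind
  · grind
  · grind
  · omega

theorem idd_pmul_le (A : Set (Fin n)) (α : Dgm n) (x y : PBV n) (h : (pmul (idd A) α).r x y) :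
    α.r x y := by
  let f : V3 n → PBV n := fun z => match z with
    | Sum.inl i => Sum.inl i
    | Sum.inr (Sum.inl i) => Sum.inl i
    | Sum.inr (Sum.inr i) => Sum.inr i
  have := pmul_lab (fun z => (Quotient.mk α (f z))) ?_ ?_ h
  · have e : ∀ x, f (topBot x) = x := by rintro (x | x) <;> rfl
    rw [← e x, ← e y]
    exact Quotient.exact this
  · intro a b hab
    rw [idd_r] at hab
    rcases hab with rfl | ⟨c, _, ⟨rfl, rfl⟩ | ⟨rfl, rfl⟩⟩ <;> rfl
  · have e : ∀ x, f (midBot x) = x := by rintro (x | x) <;> rfl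
    intro a b hab
    simp only [e]
    exact Quotient.sound hab

theorem idd_univ_pmul (α : Dgm n) : pmul (idd Set.univ) α = α := by
  apply dext; intro x y
  constructor
  · exact idd_pmul_le _ _ _ _
  · intro h
    have step : ∀ x : PBV n, RGen (prodEdges (idd Set.univ) α) (topBot x) (midBot x) := by
      rintro (x | x)
      · have : (idd Set.univ).r (Sum.inl x) (Sum.inr x) := by rw [idd_r]; right; exact ⟨x, by simp⟩
        exact edge_top this
      · exact RGen.refl _
    exact (step x).trans ((edge_bot h).trans (step y).symm)

theorem idd_star (A : Set (Fin n)) : pstar (idd A) = idd A := by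
  apply dext; intro x y
  rw [pstar_r, idd_r, idd_r]
  rcases x with x | x <;> rcases y with y | y <;> simp [swapUD]

theorem pmul_idd_univ (α : Dgm n) : pmul α (idd Set.univ) = α := by
  have := idd_univ_pmul (pstar α)
  have h2 := congrArg pstar this
  rwa [pstar_pmul, pstar_pstar, idd_star] at h2

theorem idd_dom (A : Set (Fin n)) : domSet (idd A) = A := by
  ext i
  simp only [domSet, Set.mem_ofPred_eq, idd_r]
  simp

theorem dom_star (α : Dgm n) : domSet (pstar α) = codomSet α := rfl
theorem codom_star (α : Dgm n) : codomSet (pstar α) = domSet α := rfl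

theorem idd_codom (A : Set (Fin n)) : codomSet (idd A) = A := by
  rw [← dom_star, idd_star, idd_dom]

theorem idd_eta (A : Set (Fin n)) (i : Fin n) : pmul (idd A) (eta i i) = idd (A \ {i}) := by
  apply dext; intro x y
  rw [pmul_eta_r _ _ _ le_rfl, plusS_r]
  simp only [idd_r]
  rcases x with x | x <;> rcases y with y | y <;> simp [LowI] <;> grind

/-- facts about blocks avoiding the middle row -/
theorem not_dom_reach (α β : Dgm n) (u : Fin n) (hu : u ∉ domSet α) (z : V3 n)
    (h : RGen (prodEdges α β) (Sum.inl u) z) : ∃ v, z = Sum.inl v ∧ α.r (Sum.inl u) (Sum.inl v) := by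
  let c : V3 n → Prop := fun z => ∃ v, z = Sum.inl v ∧ α.r (Sum.inl u) (Sum.inl v)
  have hc : ∀ a : PBV n, c (topMid a) ↔ α.r (Sum.inl u) a := by
    rintro (a | a)
    · simp [c, topMid]
    · simp only [c, topMid]
      constructor
      · rintro ⟨v, hv, _⟩; cases hv
      · intro h; exact absurd ⟨a, h⟩ hu
  have hd : ∀ a : PBV n, ¬ c (midBot a) := by
    rintro (a | a) ⟨v, hv, _⟩ <;> cases hv
  have := pmul_lab c ?_ ?_ h
  · have h0 : c (Sum.inl u) := ⟨u, rfl, srefl α _⟩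
    rw [this] at h0
    exact h0
  · intro a b hab
    rw [hc, hc]
    exact propext ⟨fun h => strans α _ _ _ h hab, fun h => strans α _ _ _ h (ssymm α _ _ hab)⟩
  · intro a b _
    exact propext ⟨fun h => absurd h (hd a), fun h => absurd h (hd b)⟩

theorem dom_pmul (α β : Dgm n) : domSet (pmul α β) ⊆ domSet α := by
  rintro u ⟨j, hj⟩
  by_contra hu
  obtain ⟨v, hv, _⟩ := not_dom_reach α β u hu _ hj
  cases hv

theorem not_dom_hook (α β : Dgm n) (u v : Fin n) (hu : u ∉ domSet α)
    (h : (pmul α β).r (Sum.inl u) (Sum.inl v)) : α.r (Sum.inl u) (Sum.inl v) := by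
  obtain ⟨w, hw, h2⟩ := not_dom_reach α β u hu _ h
  cases hw; exact h2

end Dgm

namespace Dgm
variable {n : ℕ}

theorem vpos_inj {x y : PBV n} (h : vpos x = vpos y) : x = y := by
  rcases x with x | x <;> rcases y with y | y <;> simp only [vpos] at h
  · exact congrArg _ (Fin.ext h)
  · omega
  · omega
  · exact congrArg _ (Fin.ext (by omega))

theorem LowI_vpos (i k : Fin n) (x : PBV n) :
    LowI i k x ↔ vpos (Sum.inr k : PBV n) ≤ vpos x ∧ vpos x ≤ vpos (Sum.inr i : PBV n) := by
  rcases x with x | x <;> simp only [LowI, vpos]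
  · constructor
    · exact False.elim
    · omega
  · rw [Fin.le_def, Fin.le_def]; omega

theorem planar_jd {α : Dgm n} (hα : IsPlanar α) {a b c d x y : PBV n} {lo hi : ℕ}
    (hax : α.r a x) (hby : α.r b y) (hcd : α.r c d)
    (hx : lo ≤ vpos x ∧ vpos x ≤ hi) (hy : lo ≤ vpos y ∧ vpos y ≤ hi)
    (_ha : vpos a < lo ∨ hi < vpos a) (_hb : vpos b < lo ∨ hi < vpos b)
    (hc : vpos c < lo ∨ hi < vpos c) (hd : vpos d < lo ∨ hi < vpos d)
    (h1 : vpos a < vpos c) (h2 : vpos c < vpos b) (h3 : vpos b < vpos d) : False := by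
  rcases hc with hc | hc
  · rcases hd with hd | hd
    · exact hα c d b y hcd hby (by omega) (by omega) (by omega)
    · exact hα a x c d hax hcd (by omega) (by omega) (by omega)
  · exact hα y b c d (ssymm α _ _ hby) hcd (by omega) (by omega) (by omega)

theorem planar_dj {α : Dgm n} (hα : IsPlanar α) {a b c d x y : PBV n} {lo hi : ℕ}
    (hcx : α.r c x) (hdy : α.r d y) (hab : α.r a b)
    (hx : lo ≤ vpos x ∧ vpos x ≤ hi) (hy : lo ≤ vpos y ∧ vpos y ≤ hi)
    (ha : vpos a < lo ∨ hi < vpos a) (hb : vpos b < lo ∨ hi < vpos b)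
    (_hc : vpos c < lo ∨ hi < vpos c) (_hd : vpos d < lo ∨ hi < vpos d)
    (h1 : vpos a < vpos c) (h2 : vpos c < vpos b) (h3 : vpos b < vpos d) : False := by
  rcases hb with hb | hb
  · exact hα a b c x hab hcx (by omega) (by omega) (by omega)
  · rcases ha with ha | ha
    · exact hα a b y d hab (ssymm α _ _ hdy) (by omega) (by omega) (by omega)
    · exact hα x c a b (ssymm α _ _ hcx) hab (by omega) (by omega) (by omega)

theorem LowI_left (i k : Fin n) (h : i ≤ k) : LowI i k (Sum.inr i : PBV n) := ⟨le_rfl, h⟩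
theorem LowI_right (i k : Fin n) (h : i ≤ k) : LowI i k (Sum.inr k : PBV n) := ⟨h, le_rfl⟩

theorem pmul_eta_PB (α : Dgm n) (i k : Fin n) (hik : i ≤ k) (hα : IsPB α) :
    IsPB (pmul α (eta i k)) := by
  intro x y z hxy hxz
  rw [pmul_eta_r _ _ _ hik, plusS_r] at hxy hxz
  have l1 := LowI_left i k hik
  have l2 := LowI_right i k hik
  have t := strans α
  have s := ssymm α
  have pb := hα
  unfold IsPB at pb
  generalize (Sum.inr i : PBV n) = p at *
  generalize (Sum.inr k : PBV n) = q at *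
  rcases hxy with hxy | hxy | hxy | ⟨hx, hy, hxy⟩
  · exact Or.inl hxy
  · grind
  · grind
  rcases hxz with hxz | hxz | hxz | ⟨_, hz, hxz⟩
  · exact Or.inr (Or.inl hxz)
  · grind
  · grind
  have nx : ∀ w, LowI i k w → x ≠ w := fun w h e => hx (e ▸ h)
  have ny : ∀ w, LowI i k w → y ≠ w := fun w h e => hy (e ▸ h)
  have nz : ∀ w, LowI i k w → z ≠ w := fun w h e => hz (e ▸ h)
  have x1 := nx p l1
  have x2 := nx q l2
  have y1 := ny p l1
  have y2 := ny q l2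
  have z1 := nz p l1
  have z2 := nz q l2
  clear nx ny nz
  rcases hxy with hxy | ⟨h1, h2⟩ | ⟨h1, h2⟩ <;> rcases hxz with hxz | ⟨h3, h4⟩ | ⟨h3, h4⟩
  · exact pb _ _ _ hxy hxz
  · have := pb _ _ _ hxy h3; grind
  · have := pb _ _ _ hxy h3; grind
  · have := pb _ _ _ h1 hxz; grind
  · have := pb _ _ _ (s _ _ h2) (s _ _ h4); grind
  · have := pb _ _ _ h1 h3
    have e : p = q := by grind
    subst e
    have := pb _ _ _ (s _ _ h2) (s _ _ h4); grind
  · have := pb _ _ _ h1 hxz; grind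
  · have := pb _ _ _ h1 h3
    have e : p = q := by grind
    subst e
    have := pb _ _ _ (s _ _ h2) (s _ _ h4); grind
  · have := pb _ _ _ (s _ _ h2) (s _ _ h4); grind

theorem pmul_eta_planar (α : Dgm n) (i k : Fin n) (hik : i ≤ k) (hα : IsPB α) (hp : IsPlanar α) :
    IsPlanar (pmul α (eta i k)) := by
  intro a b c d hab hcd h1 h2 h3
  rw [pmul_eta_r _ _ _ hik, plusS_r] at hab hcd
  have l1 := (LowI_vpos i k _).1 (LowI_left i k hik)
  have l2 := (LowI_vpos i k _).1 (LowI_right i k hik)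
  rw [LowI_vpos, LowI_vpos] at hab hcd
  have s := ssymm α
  have pb := hα
  unfold IsPB at pb
  generalize (Sum.inr i : PBV n) = p at *
  generalize (Sum.inr k : PBV n) = q at *
  rcases hab with rfl | ⟨rfl, rfl⟩ | ⟨rfl, rfl⟩ | ⟨ha, hb, hab⟩
  · omega
  · omega
  · rcases hcd with rfl | ⟨rfl, rfl⟩ | ⟨rfl, rfl⟩ | ⟨hc, hd, hcd⟩ <;> omega
  rcases hcd with rfl | ⟨rfl, rfl⟩ | ⟨rfl, rfl⟩ | ⟨hc, hd, hcd⟩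
  · omega
  · omega
  · omega
  have ha' : vpos a < vpos q ∨ vpos p < vpos a := by omega
  have hb' : vpos b < vpos q ∨ vpos p < vpos b := by omega
  have hc' : vpos c < vpos q ∨ vpos p < vpos c := by omega
  have hd' : vpos d < vpos q ∨ vpos p < vpos d := by omega
  have ne : ∀ x y : PBV n, vpos x ≠ vpos y → x ≠ y := fun x y h e => h (e ▸ rfl)
  have key : ∀ x y z : PBV n, α.r x z → α.r y z → vpos x ≠ vpos y → vpos x ≠ vpos z →
      vpos y ≠ vpos z → False := by
    intro x y z hx hy n1 n2 n3
    rcases pb z x y (s _ _ hx) (s _ _ hy) with e | e | e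
    · exact n2 (e ▸ rfl)
    · exact n3 (e ▸ rfl)
    · exact n1 (e ▸ rfl)
  rcases hab with hab | ⟨ha1, hb1⟩ | ⟨ha1, hb1⟩ <;> rcases hcd with hcd | ⟨hc1, hd1⟩ | ⟨hc1, hd1⟩
  · exact hp a b c d hab hcd h1 h2 h3
  · exact planar_dj hp hc1 hd1 hab l1 l2 ha' hb' hc' hd' h1 h2 h3
  · exact planar_dj hp hc1 hd1 hab l2 l1 ha' hb' hc' hd' h1 h2 h3
  · exact planar_jd hp ha1 hb1 hcd l1 l2 ha' hb' hc' hd' h1 h2 h3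
  · exact key a c p ha1 hc1 (by omega) (by omega) (by omega)
  · exact key a d p ha1 hd1 (by omega) (by omega) (by omega)
  · exact planar_jd hp ha1 hb1 hcd l2 l1 ha' hb' hc' hd' h1 h2 h3
  · exact key a d q ha1 hd1 (by omega) (by omega) (by omega)
  · exact key a c q ha1 hc1 (by omega) (by omega) (by omega)

theorem pmul_eta_M (α : Dgm n) (i k : Fin n) (hik : i ≤ k) (hα : α ∈ Mset n) :
    pmul α (eta i k) ∈ Mset n :=
  ⟨pmul_eta_PB α i k hik hα.1, pmul_eta_planar α i k hik hα.1 hα.2⟩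

theorem idd_M (A : Set (Fin n)) : idd A ∈ Mset n := by
  constructor
  · intro x y z h1 h2
    rw [idd_r] at h1 h2
    rcases h1 with h1 | ⟨a, ha, h1 | h1⟩ <;> rcases h2 with h2 | ⟨b, hb, h2 | h2⟩ <;> grind
  · intro a b c d h1 h2 h3 h4 h5
    rw [idd_r] at h1 h2
    rcases h1 with rfl | ⟨u, hu, ⟨rfl, rfl⟩ | ⟨rfl, rfl⟩⟩ <;>
      rcases h2 with rfl | ⟨v, hv, ⟨rfl, rfl⟩ | ⟨rfl, rfl⟩⟩ <;> simp only [vpos] at h3 h4 h5 <;> omega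

theorem eta_M (i k : Fin n) (hik : i ≤ k) : eta i k ∈ Mset n := by
  have := pmul_eta_M (idd Set.univ) i k hik (idd_M _)
  rwa [idd_univ_pmul] at this

theorem eta_idpt (i k : Fin n) (hik : i ≤ k) : IsIdpt (eta i k) := by
  apply dext; intro x y
  rw [pmul_eta_r _ _ _ hik, plusS_r]
  simp only [eta_r]
  have hp : ¬ LowI i k x → ¬ LowI i k y → (etaLab i k x = etaLab i k (Sum.inr i) → False) := by
    intro h1 h2 h
    rcases x with x | x <;> simp only [etaLab, LowI] at h h1 <;> grind
  have hq : ¬ LowI i k x → ¬ LowI i k y → (etaLab i k x = etaLab i k (Sum.inr k) → False) := by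
    intro h1 h2 h
    rcases x with x | x <;> simp only [etaLab, LowI] at h h1 <;> grind
  have hi : etaLab i k (Sum.inr i) = etaLab i k (Sum.inr k) := by
    simp only [etaLab]; grind
  constructor
  · grind
  · intro h
    by_cases h1 : LowI i k x
    · rcases x with x | x <;> rcases y with y | y <;> simp only [etaLab, LowI] at h h1 ⊢ <;> grind
    · by_cases h2 : LowI i k y
      · rcases x with x | x <;> rcases y with y | y <;> simp only [etaLab, LowI] at h h1 h2 ⊢ <;> grind
      · grind

theorem idd_univ_idpt : IsIdpt (idd (Set.univ : Set (Fin n))) := idd_univ_pmul _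

theorem pstar_M {α : Dgm n} (h : α ∈ Mset n) : pstar α ∈ Mset n := by
  constructor
  · intro x y z h1 h2
    rw [pstar_r] at h1 h2
    have := h.1 _ _ _ h1 h2
    simpa only [swapUD_eq, swapUD_swapUD] using this
  · intro a b c d h1 h2 h3 h4 h5
    rw [pstar_r] at h1 h2
    have e : ∀ x : PBV n, vpos (swapUD x) = 2 * n - 1 - vpos x ∧ vpos x ≤ 2 * n - 1 := by
      rintro (x | x)
      · have := x.2
        refine ⟨rfl, ?_⟩
        show (x : ℕ) ≤ _
        omega
      · have := x.2
        constructor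
        · show (x : ℕ) = 2 * n - 1 - (2 * n - 1 - (x : ℕ))
          omega
        · show 2 * n - 1 - (x : ℕ) ≤ 2 * n - 1
          omega
    have ea := e a
    have eb := e b
    have ec := e c
    have ed := e d
    exact h.2 (swapUD d) (swapUD c) (swapUD b) (swapUD a) (ssymm α _ _ h2) (ssymm α _ _ h1)
      (by omega) (by omega) (by omega)

/-- the right-hand side -/
def TT (n : ℕ) : Set (Dgm n) := {α | ∃ A : Set (Fin n), CosparseS A ∧ α = idd A} ∪
        {α | α ∈ Mset n ∧ ¬ CosparseS (domSet α) ∧ ¬ CosparseS (codomSet α)}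

theorem TT_M {α : Dgm n} (h : α ∈ TT n) : α ∈ Mset n := by
  rcases h with ⟨A, _, rfl⟩ | h
  · exact idd_M A
  · exact h.1

theorem idd_TT (A : Set (Fin n)) : idd A ∈ TT n := by
  by_cases h : CosparseS A
  · exact Or.inl ⟨A, h, rfl⟩
  · exact Or.inr ⟨idd_M A, by rwa [idd_dom], by rwa [idd_codom]⟩

theorem not_cosparse {A : Set (Fin n)} : ¬ CosparseS A ↔
    ∃ i j : Fin n, i ∉ A ∧ j ∉ A ∧ (j : ℕ) = i + 1 := by
  unfold CosparseS; push Not; rfl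

theorem not_cosparse_mono {A B : Set (Fin n)} (h : A ⊆ B) (hB : ¬ CosparseS B) : ¬ CosparseS A := by
  rw [not_cosparse] at *
  obtain ⟨i, j, h1, h2, h3⟩ := hB
  exact ⟨i, j, fun h' => h1 (h h'), fun h' => h2 (h h'), h3⟩

theorem codom_pmul (α β : Dgm n) : codomSet (pmul α β) ⊆ codomSet β := by
  have := dom_pmul (pstar β) (pstar α)
  rwa [← pstar_pmul, dom_star, dom_star] at this

theorem eta_codom (i k u : Fin n) (h1 : i ≤ u) (h2 : u ≤ k) : u ∉ codomSet (eta i k) := by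
  rintro ⟨j, hj⟩
  rw [eta_r] at hj
  simp only [etaLab] at hj
  grind

theorem eta_dom (i k u : Fin n) (h1 : i ≤ u) (h2 : u ≤ k) : u ∉ domSet (eta i k) := by
  have := eta_codom i k u h1 h2
  rwa [← dom_star, eta_star] at this

theorem eta_codom_nc (i k : Fin n) (hik : i < k) : ¬ CosparseS (codomSet (eta i k)) := by
  rw [not_cosparse]
  have hk : (i : ℕ) < k := hik
  exact ⟨i, ⟨i + 1, by omega⟩, eta_codom _ _ _ le_rfl hik.le,
    eta_codom _ _ _ (by rw [Fin.le_def]; simp) (by rw [Fin.le_def]; simp; omega), rfl⟩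

theorem eta_dom_nc (i k : Fin n) (hik : i < k) : ¬ CosparseS (domSet (eta i k)) := by
  have := eta_codom_nc i k hik
  rwa [← dom_star, eta_star] at this

theorem TT_eta {α : Dgm n} (h : α ∈ TT n) (i k : Fin n) (hik : i ≤ k) : pmul α (eta i k) ∈ TT n := by
  rcases hik.eq_or_lt with rfl | hlt
  · rcases h with ⟨A, _, rfl⟩ | h
    · rw [idd_eta]; exact idd_TT _
    · refine Or.inr ⟨pmul_eta_M _ _ _ hik h.1, not_cosparse_mono (dom_pmul _ _) h.2.1,
        not_cosparse_mono ?_ h.2.2⟩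
      rintro u ⟨j, hj⟩
      rw [pmul_eta_r _ _ _ hik, plusS_r] at hj
      have s := ssymm α
      have t := strans α
      have : α.r (Sum.inr u) (Sum.inl j) := by grind
      exact ⟨j, this⟩
  · refine Or.inr ⟨pmul_eta_M _ _ _ hik (TT_M h), ?_, not_cosparse_mono (codom_pmul _ _) (eta_codom_nc i k hlt)⟩
    rcases h with ⟨A, _, rfl⟩ | h
    · refine not_cosparse_mono ?_ (eta_dom_nc i k hlt)
      rintro u ⟨j, hj⟩
      exact ⟨j, idd_pmul_le _ _ _ _ hj⟩
    · exact not_cosparse_mono (dom_pmul _ _) h.2.1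

/-- the generators -/
def XX (n : ℕ) : Set (Dgm n) :=
  {α | α = idd Set.univ ∨ ∃ i k : Fin n, i ≤ k ∧ (k : ℕ) ≤ i + 2 ∧ α = eta i k}

theorem XX_idpt {α : Dgm n} (h : α ∈ XX n) : α ∈ Mset n ∧ IsIdpt α := by
  rcases h with rfl | ⟨i, k, h1, h2, rfl⟩
  · exact ⟨idd_M _, idd_univ_idpt⟩
  · exact ⟨eta_M _ _ h1, eta_idpt _ _ h1⟩

theorem gen_XX_TT {α : Dgm n} (h : α ∈ genSet (pmul (n := n)) (XX n)) : α ∈ TT n := by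
  have key : ∀ β ∈ TT n, pmul β α ∈ TT n := by
    have h' : MClo (pmul (n := n)) (XX n) α := h
    clear h
    induction h' with
    | base hx =>
      intro β hβ
      rcases hx with rfl | ⟨i, k, h1, h2, rfl⟩
      · rwa [pmul_idd_univ]
      · exact TT_eta hβ _ _ h1
    | mul _ _ ih1 ih2 =>
      intro β hβ
      rw [← pmul_assoc]
      exact ih2 _ (ih1 _ hβ)
  have := key _ (idd_TT Set.univ)
  rwa [idd_univ_pmul] at this

end Dgm

namespace Dgm
variable {n : ℕ}

theorem hook_not_dom {α : Dgm n} (hα : α ∈ Mset n) {u v w : Fin n}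
    (h : α.r (Sum.inl u) (Sum.inl v)) (huv : u < v) (h1 : u ≤ w) (h2 : w ≤ v) : w ∉ domSet α := by
  rintro ⟨j, hj⟩
  rcases h1.eq_or_lt with rfl | h1
  · have := hα.1 _ _ _ h hj
    simp only [Sum.inl.injEq, reduceCtorEq, or_false] at this
    exact huv.ne this
  rcases h2.eq_or_lt with rfl | h2
  · have := hα.1 _ _ _ (ssymm α _ _ h) hj
    simp only [Sum.inl.injEq, reduceCtorEq, or_false] at this
    exact huv.ne' this
  · refine hα.2 _ _ _ _ h hj h1 h2 ?_
    simp only [vpos]; omega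

theorem no_hook {α : Dgm n} (hα : α ∈ Mset n) (hc : CosparseS (domSet α)) (u v : Fin n)
    (h : α.r (Sum.inl u) (Sum.inl v)) : u = v := by
  have key : ∀ u v : Fin n, α.r (Sum.inl u) (Sum.inl v) → u < v → False := by
    intro u v h huv
    have h' : (u : ℕ) < v := huv
    refine hc u ⟨u + 1, by omega⟩ (hook_not_dom hα h huv le_rfl huv.le) (hook_not_dom hα h huv ?_ ?_) rfl
    · rw [Fin.le_def]; simp
    · rw [Fin.le_def]; simp; omega
  rcases lt_trichotomy u v with h1 | h1 | h1
  · exact (key _ _ h h1).elim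
  · exact h1
  · exact (key _ _ (ssymm α _ _ h) h1).elim

theorem idpt_trans {α : Dgm n} (hα : α ∈ Mset n) (hi : IsIdpt α) (hc : CosparseS (domSet α))
    (i j : Fin n) (h : α.r (Sum.inl i) (Sum.inr j)) : i = j := by
  by_cases hj : j ∈ domSet α
  · obtain ⟨k, hk⟩ := hj
    have h2 : (pmul α α).r (Sum.inl i) (Sum.inr k) := (edge_top h).trans (edge_bot hk)
    rw [hi] at h2
    have e := hα.1 _ _ _ h h2
    simp only [Sum.inr.injEq, reduceCtorEq, false_or] at e
    subst e
    have e := hα.1 _ _ _ (ssymm α _ _ h) (ssymm α _ _ hk)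
    simpa only [Sum.inl.injEq, reduceCtorEq, false_or] using e
  · exfalso
    have hs : ∀ y, α.r (Sum.inl j) y → y = Sum.inl j := by
      rintro (y | y) hy
      · rw [no_hook hα hc _ _ hy]
      · exact (hj ⟨y, hy⟩).elim
    have h2 : (pmul α α).r (Sum.inl i) (Sum.inr j) := by rw [hi]; exact h
    have hl := pmul_lab (fun x : V3 n => (x = Sum.inl i ∨ x = Sum.inr (Sum.inl j))) ?_ ?_ h2
    · simp [topBot] at hl
    · have key : ∀ a b, α.r a b → (topMid a = Sum.inl i ∨ topMid a = Sum.inr (Sum.inl j)) →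
          (topMid b = Sum.inl i ∨ topMid b = Sum.inr (Sum.inl j)) := by
        intro a b hab ha
        have ha' : a = Sum.inl i ∨ a = Sum.inr j := by
          rcases a with a | a <;> simp [topMid] at ha ⊢ <;> exact ha
        have hb' : b = Sum.inl i ∨ b = Sum.inr j := by
          rcases ha' with rfl | rfl
          · have := hα.1 _ _ _ hab h; grind
          · have := hα.1 _ _ _ hab (ssymm α _ _ h); grind
        rcases hb' with rfl | rfl
        · exact Or.inl rfl
        · exact Or.inr rfl
      intro a b hab
      exact propext ⟨key a b hab, key b a (ssymm α _ _ hab)⟩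
    · have key : ∀ a b, α.r a b → (midBot a = Sum.inl i ∨ midBot a = Sum.inr (Sum.inl j)) →
          (midBot b = Sum.inl i ∨ midBot b = Sum.inr (Sum.inl j)) := by
        intro a b hab ha
        have ha' : a = Sum.inl j := by
          rcases a with a | a <;> simp [midBot] at ha ⊢
          exact ha
        subst ha'
        rw [hs b hab]
        exact Or.inr rfl
      intro a b hab
      exact propext ⟨key a b hab, key b a (ssymm α _ _ hab)⟩

theorem eq_idd {α : Dgm n} (hu : ∀ u v : Fin n, α.r (Sum.inl u) (Sum.inl v) → u = v)
    (hd : ∀ u v : Fin n, α.r (Sum.inr u) (Sum.inr v) → u = v)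
    (ht : ∀ u v : Fin n, α.r (Sum.inl u) (Sum.inr v) → u = v) : α = idd (domSet α) := by
  apply dext; intro x y
  rw [idd_r]
  constructor
  · intro h
    rcases x with x | x <;> rcases y with y | y
    · left; rw [hu _ _ h]
    · right
      obtain rfl := ht _ _ h
      exact ⟨x, ⟨x, h⟩, Or.inl ⟨rfl, rfl⟩⟩
    · right
      obtain rfl := ht _ _ (ssymm α _ _ h)
      exact ⟨y, ⟨y, ssymm α _ _ h⟩, Or.inr ⟨rfl, rfl⟩⟩
    · left; rw [hd _ _ h]
  · rintro (rfl | ⟨a, ⟨b, hb⟩, ⟨rfl, rfl⟩ | ⟨rfl, rfl⟩⟩)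
    · exact srefl α _
    · obtain rfl := ht _ _ hb
      exact hb
    · obtain rfl := ht _ _ hb
      exact ssymm α _ _ hb

theorem idpt_dom {α : Dgm n} (hα : α ∈ Mset n) (hi : IsIdpt α) (hc : CosparseS (domSet α)) :
    α = idd (domSet α) := by
  have ht := idpt_trans hα hi hc
  refine eq_idd (no_hook hα hc) ?_ ht
  have e : domSet (pstar α) = domSet α := by
    rw [dom_star]
    ext u
    constructor
    · rintro ⟨j, hj⟩
      have := ht _ _ (ssymm α _ _ hj)
      subst this
      exact ⟨j, ssymm α _ _ hj⟩
    · rintro ⟨j, hj⟩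
      have := ht _ _ hj
      subst this
      exact ⟨u, ssymm α _ _ hj⟩
  intro u v h
  exact no_hook (pstar_M hα) (by rwa [e]) u v h

theorem idpt_TT {α : Dgm n} (hα : α ∈ Mset n) (hi : IsIdpt α) : α ∈ TT n := by
  by_cases hc : CosparseS (domSet α)
  · exact Or.inl ⟨_, hc, idpt_dom hα hi hc⟩
  by_cases hd : CosparseS (codomSet α)
  · have h1 : IsIdpt (pstar α) := by
      unfold IsIdpt
      rw [← pstar_pmul, hi]
    have := idpt_dom (pstar_M hα) h1 (by rwa [dom_star])
    rw [← pstar_pstar α, this, idd_star]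
    exact idd_TT _
  · exact Or.inr ⟨hα, hc, hd⟩

end Dgm

namespace Dgm
variable {n : ℕ}

/-- the subsemigroup generated by the generators -/
def RR (n : ℕ) : Set (Dgm n) := genSet (pmul (n := n)) (XX n)

theorem RR_mul {α β : Dgm n} (h1 : α ∈ RR n) (h2 : β ∈ RR n) : pmul α β ∈ RR n := MClo.mul h1 h2

theorem RR_eta (i k : Fin n) (h1 : i ≤ k) (h2 : (k : ℕ) ≤ i + 2) : eta i k ∈ RR n :=
  MClo.base (Or.inr ⟨i, k, h1, h2, rfl⟩)

theorem RR_star {α : Dgm n} (h : α ∈ RR n) : pstar α ∈ RR n := by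
  have h' : MClo (pmul (n := n)) (XX n) α := h
  clear h
  induction h' with
  | base hx =>
    rcases hx with rfl | ⟨i, k, h1, h2, rfl⟩
    · rw [idd_star]; exact MClo.base (Or.inl rfl)
    · rw [eta_star]; exact RR_eta i k h1 h2
  | mul _ _ ih1 ih2 =>
    rw [pstar_pmul]; exact RR_mul ih2 ih1

theorem RR_idd (A : Set (Fin n)) : idd A ∈ RR n := by
  have key : ∀ B : Finset (Fin n), idd (Set.univ \ (B : Set (Fin n))) ∈ RR n := by
    intro B
    induction B using Finset.induction_on with
    | empty =>
      rw [Finset.coe_empty, Set.sdiff_empty]; exact MClo.base (Or.inl rfl)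
    | insert b B _ ih =>
      have e : Set.univ \ ((insert b B : Finset (Fin n)) : Set (Fin n)) =
          (Set.univ \ (B : Set (Fin n))) \ {b} := by
        ext u; simp [not_or, and_comm]
      rw [e, ← idd_eta]
      exact RR_mul ih (RR_eta b b le_rfl (by omega))
  have e : A = Set.univ \ ((Finset.univ.filter (fun u => u ∉ A) : Finset (Fin n)) : Set (Fin n)) := by
    ext u; simp
  rw [e]; exact key _

theorem RR_op1 (i : Fin n) {α : Dgm n} (h : α ∈ RR n) : op1 (Sum.inl i) α ∈ RR n := by
  rw [← eta_op1]; exact RR_mul (RR_eta _ _ le_rfl (by omega)) h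

theorem RR_op2 (i k : Fin n) (hik : (k : ℕ) = i + 1 ∨ (i : ℕ) = k + 1) {α : Dgm n} (h : α ∈ RR n) :
    op2 (Sum.inl i) (Sum.inl k) α ∈ RR n := by
  rcases hik with hik | hik
  · rw [← eta_op2 _ _ hik]; exact RR_mul (RR_eta _ _ (by rw [Fin.le_def]; omega) (by omega)) h
  · rw [op2_comm, ← eta_op2 _ _ hik]
    exact RR_mul (RR_eta _ _ (by rw [Fin.le_def]; omega) (by omega)) h

theorem RR_op3 (i j k : Fin n) (hik : ((j : ℕ) = i + 1 ∧ (k : ℕ) = j + 1) ∨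
    ((j : ℕ) = k + 1 ∧ (i : ℕ) = j + 1)) {α : Dgm n} (h : α ∈ RR n) :
    op3 (Sum.inl i) (Sum.inl j) (Sum.inl k) α ∈ RR n := by
  rcases hik with hik | hik
  · rw [← eta_op3 _ _ _ hik.1 hik.2]
    exact RR_mul (RR_eta _ _ (by rw [Fin.le_def]; omega) (by omega)) h
  · rw [op3_comm, ← eta_op3 _ _ _ hik.1 hik.2]
    exact RR_mul (RR_eta _ _ (by rw [Fin.le_def]; omega) (by omega)) h

theorem inl_ne {i j : Fin n} (h : (i : ℕ) ≠ j) : (Sum.inl i : PBV n) ≠ Sum.inl j := by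
  intro e; exact h (congrArg _ (Sum.inl.inj e))

/-- swap with classical decidability -/
def gsw {V : Type*} (p q : V) : Equiv.Perm V := Equiv.swap p q

theorem gsw_comm {V : Type*} (p q : V) : gsw p q = gsw q p := Equiv.swap_comm _ _
theorem gsw_other {V : Type*} (p q x : V) (h1 : x ≠ p) (h2 : x ≠ q) : gsw p q x = x :=
  Equiv.swap_apply_of_ne_of_ne h1 h2
theorem gsw_left {V : Type*} (p q : V) : gsw p q p = q := Equiv.swap_apply_left _ _
theorem gsw_right {V : Type*} (p q : V) : gsw p q q = p := Equiv.swap_apply_right _ _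

/-- swap of two upper points -/
def sw (i k : Fin n) : Equiv.Perm (PBV n) := gsw (Sum.inl i) (Sum.inl k)

theorem sw_comm (i k : Fin n) : sw i k = sw k i := gsw_comm _ _

theorem sw_sw (i k : Fin n) (α : Dgm n) : Setoid.comap (sw i k) (Setoid.comap (sw i k) α) = α := by
  apply dext; intro x y
  rw [comap_r, comap_r]
  simp [sw, gsw]

theorem S2R (α : Dgm n) (i j k : Fin n) (hc : ((j : ℕ) = i + 1 ∧ (k : ℕ) = j + 1) ∨
    ((j : ℕ) = k + 1 ∧ (i : ℕ) = j + 1)) (hj : Sing α (Sum.inl j)) (hk : Sing α (Sum.inl k))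
    (h : Setoid.comap (sw i k) α ∈ RR n) : α ∈ RR n := by
  rw [← S2abs α (Sum.inl i) (Sum.inl j) (Sum.inl k) (inl_ne (by omega)) (inl_ne (by omega))
    (inl_ne (by omega)) hj hk]
  exact RR_op1 _ (RR_op2 _ _ (by omega) (RR_op2 _ _ (by omega) h))

theorem S3R (α : Dgm n) (i l j k : Fin n)
    (hc : ((l : ℕ) = i + 1 ∧ (j : ℕ) = l + 1 ∧ (k : ℕ) = j + 1) ∨
    ((j : ℕ) = k + 1 ∧ (l : ℕ) = j + 1 ∧ (i : ℕ) = l + 1)) (hl : Sing α (Sum.inl l))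
    (hj : Sing α (Sum.inl j)) (hk : Sing α (Sum.inl k))
    (h : Setoid.comap (sw i k) α ∈ RR n) : α ∈ RR n := by
  rw [← S3abs α (Sum.inl i) (Sum.inl l) (Sum.inl j) (Sum.inl k) (inl_ne (by omega))
    (inl_ne (by omega)) (inl_ne (by omega)) (inl_ne (by omega)) (inl_ne (by omega))
    (inl_ne (by omega)) hl hj hk]
  exact RR_op1 _ (RR_op2 _ _ (by omega) (RR_op3 _ _ _ (by omega) h))

theorem sw_other (i k : Fin n) (x : PBV n) (h1 : x ≠ Sum.inl i) (h2 : x ≠ Sum.inl k) :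
    sw i k x = x := gsw_other _ _ _ h1 h2
theorem sw_left (i k : Fin n) : sw i k (Sum.inl i) = Sum.inl k := gsw_left _ _
theorem sw_right (i k : Fin n) : sw i k (Sum.inl k) = Sum.inl i := gsw_right _ _

/-- converse of `S2R` -/
theorem S2R' (α : Dgm n) (i j k : Fin n) (hc : ((j : ℕ) = i + 1 ∧ (k : ℕ) = j + 1) ∨
    ((j : ℕ) = k + 1 ∧ (i : ℕ) = j + 1)) (hj : Sing α (Sum.inl j)) (hk : Sing α (Sum.inl k))
    (h : α ∈ RR n) : Setoid.comap (sw i k) α ∈ RR n := by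
  refine S2R _ k j i (by omega) (sing_comap _ _ _ ?_) (sing_comap _ _ _ ?_) ?_
  · rw [sw_other _ _ _ (inl_ne (by omega)) (inl_ne (by omega))]; exact hj
  · rw [sw_left]; exact hk
  · rw [sw_comm k i, sw_sw]; exact h

theorem op1_comap {V : Type*} (f : Equiv.Perm V) (p : V) (α : Setoid V) (hf : f p = p) :
    op1 p (Setoid.comap f α) = Setoid.comap f (op1 p α) := by
  apply dext; intro x y
  rw [op1_r, comap_r f α, comap_r f (op1 p α), op1_r]
  have : ∀ z, f z = p ↔ z = p := by
    intro z
    constructor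
    · intro h; exact f.injective (h.trans hf.symm)
    · rintro rfl; exact hf
  rw [f.injective.eq_iff, Ne, Ne, Ne, Ne, this, this]

theorem sing_op1 {V : Type*} (p q : V) (α : Setoid V) (h : Sing α q) : Sing (op1 p α) q := by
  intro y hy
  rw [op1_r] at hy
  rcases hy with hy | hy
  · exact hy.symm
  · exact h y hy.2.2

theorem hookR (d : ℕ) : ∀ (α : Dgm n) (i k : Fin n), (k : ℕ) = i + d + 1 →
    α.r (Sum.inl i) (Sum.inl k) → (∀ y, α.r (Sum.inl i) y → y = Sum.inl i ∨ y = Sum.inl k) →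
    (∀ w, i < w → w < k → Sing α (Sum.inl w)) → op1 (Sum.inl k) α ∈ RR n → α ∈ RR n := by
  induction d using Nat.strong_induction_on with
  | _ d ih =>
  intro α i k hk hr hp hs ho
  match d, ih, hk with
  | 0, ih, hk =>
    rw [← K2abs α (Sum.inl i) (Sum.inl k) (inl_ne (by omega)) hr hp]
    exact RR_op2 _ _ (by omega) ho
  | 1, ih, hk =>
    have hl : (i : ℕ) + 1 < n := by have := k.2; omega
    rw [← K3abs α (Sum.inl i) (Sum.inl ⟨i + 1, hl⟩) (Sum.inl k) (inl_ne (by omega))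
      (inl_ne (by simp)) (inl_ne (by simp; omega)) hr hp (hs _ (by rw [Fin.lt_def]; simp)
        (by rw [Fin.lt_def]; simp; omega))]
    exact RR_op3 _ _ _ (Or.inl ⟨rfl, by simp; omega⟩) ho
  | d + 2, ih, hk =>
    obtain ⟨m, hm⟩ : ∃ m : Fin n, (m : ℕ) = i + 1 := ⟨⟨i + 1, by have := k.2; omega⟩, rfl⟩
    obtain ⟨q, hq⟩ : ∃ q : Fin n, (q : ℕ) = i + 2 := ⟨⟨i + 2, by have := k.2; omega⟩, rfl⟩
    have sm : Sing α (Sum.inl m) := hs m (by rw [Fin.lt_def]; omega) (by rw [Fin.lt_def]; omega)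
    have sq : Sing α (Sum.inl q) := hs q (by rw [Fin.lt_def]; omega) (by rw [Fin.lt_def]; omega)
    have ek : sw i q (Sum.inl k) = Sum.inl k := sw_other _ _ _ (inl_ne (by omega)) (inl_ne (by omega))
    refine S2R α i m q (by omega) sm sq (ih d (by omega) _ q k (by omega) ?_ ?_ ?_ ?_)
    · rw [comap_r (sw i q) α, sw_right, ek]; exact hr
    · intro y hy
      rw [comap_r (sw i q) α, sw_right] at hy
      rcases hp _ hy with h | h
      · left
        apply (sw i q).injective
        rw [h, sw_right]
      · right
        apply (sw i q).injective
        rw [h, ek]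
    · intro w h1 h2
      rw [Fin.lt_def] at h1 h2
      apply sing_comap
      rw [sw_other _ _ _ (inl_ne (by omega)) (inl_ne (by omega))]
      exact hs w (by rw [Fin.lt_def]; omega) h2
    · rw [op1_comap _ _ _ ek]
      exact S2R' _ i m q (by omega) (sing_op1 _ _ _ sm) (sing_op1 _ _ _ sq) ho

theorem comap_congr_sing {V : Type*} (α : Setoid V) (f g : Equiv.Perm V)
    (h : ∀ x, f x = g x ∨ (Sing α (f x) ∧ Sing α (g x))) : Setoid.comap f α = Setoid.comap g α := by
  have hr := srefl α
  have key : ∀ (f : Equiv.Perm V) x y, Sing α (f x) → (α.r (f x) (f y) ↔ x = y) := by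
    intro f x y hs
    constructor
    · intro h; exact f.injective (hs _ h).symm
    · rintro rfl; exact hr _
  have key' : ∀ (f : Equiv.Perm V) x y, Sing α (f y) → (α.r (f x) (f y) ↔ x = y) := by
    intro f x y hs
    constructor
    · intro h; exact f.injective (sing' hs _ h)
    · rintro rfl; exact hr _
  apply dext; intro x y
  rw [comap_r f α, comap_r g α]
  rcases h x with h1 | h1
  · rcases h y with h2 | h2
    · rw [h1, h2]
    · rw [key' f x y h2.1, key' g x y h2.2]
  · rw [key f x y h1.1, key g x y h1.2]

theorem comap_comm {V : Type*} (α : Setoid V) (f g : Equiv.Perm V) (h : ∀ x, f (g x) = g (f x)) :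
    Setoid.comap f (Setoid.comap g α) = Setoid.comap g (Setoid.comap f α) := by
  apply dext; intro x y
  rw [comap_r f, comap_r g, comap_r g, comap_r f, h, h]

theorem carry (d : ℕ) : ∀ (α : Dgm n) (g g' j j' : Fin n), (g' : ℕ) = g + 1 → (j : ℕ) = g + 2 + d →
    (j' : ℕ) = j + 1 → Sing α (Sum.inl g) → Sing α (Sum.inl j) → Sing α (Sum.inl j') →
    Setoid.comap (sw g g') α ∈ RR n → α ∈ RR n := by
  induction d with
  | zero =>
    intro α g g' j j' h1 h2 h3 sg sj sj' h
    refine S2R α g' j j' (by omega) sj sj' ?_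
    refine S3R _ j' j g' g (by omega) (sing_comap _ _ _ ?_) (sing_comap _ _ _ ?_)
      (sing_comap _ _ _ ?_) ?_
    · rw [sw_other _ _ _ (inl_ne (by omega)) (inl_ne (by omega))]; exact sj
    · rw [sw_left]; exact sj'
    · rw [sw_other _ _ _ (inl_ne (by omega)) (inl_ne (by omega))]; exact sg
    · have e : Setoid.comap (sw j' g) (Setoid.comap (sw g' j') α) =
          Setoid.comap ((sw j' g).trans (sw g' j')) α := rfl
      rw [e, comap_congr_sing α _ (sw g g') ?_]
      · exact h
      · intro x
        rw [Equiv.trans_apply]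
        by_cases x1 : x = Sum.inl g
        · subst x1
          rw [sw_right, sw_right, sw_left]; exact Or.inl rfl
        by_cases x2 : x = Sum.inl g'
        · subst x2
          right
          rw [sw_other j' g _ (inl_ne (by omega)) (inl_ne (by omega)), sw_left, sw_right]
          exact ⟨sj', sg⟩
        by_cases x3 : x = Sum.inl j'
        · subst x3
          right
          rw [sw_left, sw_other _ _ _ (inl_ne (by omega)) (inl_ne (by omega)),
            sw_other _ _ _ (inl_ne (by omega)) (inl_ne (by omega))]
          exact ⟨sg, sj'⟩
        · left
          rw [sw_other _ _ _ x3 x1, sw_other _ _ _ x2 x3, sw_other _ _ _ x1 x2]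
  | succ d ih =>
    intro α g g' j j' h1 h2 h3 sg sj sj' h
    obtain ⟨m, hm⟩ : ∃ m : Fin n, (j : ℕ) = m + 1 := ⟨⟨j - 1, by omega⟩, by simp; omega⟩
    refine S2R α m j j' (by omega) sj sj' ?_
    refine ih _ g g' m j h1 (by omega) hm (sing_comap _ _ _ ?_) (sing_comap _ _ _ ?_)
      (sing_comap _ _ _ ?_) ?_
    · rw [sw_other _ _ _ (inl_ne (by omega)) (inl_ne (by omega))]; exact sg
    · rw [sw_left]; exact sj'
    · rw [sw_other _ _ _ (inl_ne (by omega)) (inl_ne (by omega))]; exact sj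
    · rw [comap_comm]
      · refine S2R' _ m j j' (by omega) (sing_comap _ _ _ ?_) (sing_comap _ _ _ ?_) h
        · rw [sw_other _ _ _ (inl_ne (by omega)) (inl_ne (by omega))]; exact sj
        · rw [sw_other _ _ _ (inl_ne (by omega)) (inl_ne (by omega))]; exact sj'
      · intro x
        have n1 : (Sum.inl g : PBV n) ≠ Sum.inl m := inl_ne (by omega)
        have n2 : (Sum.inl g : PBV n) ≠ Sum.inl j' := inl_ne (by omega)
        have n3 : (Sum.inl g' : PBV n) ≠ Sum.inl m := inl_ne (by omega)
        have n4 : (Sum.inl g' : PBV n) ≠ Sum.inl j' := inl_ne (by omega)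
        simp only [sw, gsw, Equiv.swap_apply_def]
        grind

end Dgm

namespace Dgm
variable {n : ℕ}

/-- same lower structure -/
def LowEq (β α : Dgm n) : Prop :=
  (∀ u v : Fin n, β.r (Sum.inr u) (Sum.inr v) → α.r (Sum.inr u) (Sum.inr v)) ∧ codomSet β = codomSet α

/-- no upper hooks -/
def NoUp (α : Dgm n) : Prop := ∀ u v : Fin n, α.r (Sum.inl u) (Sum.inl v) → u = v

theorem LowEq.trans {γ β α : Dgm n} (h1 : LowEq γ β) (h2 : LowEq β α) : LowEq γ α :=
  ⟨fun u v h => h2.1 u v (h1.1 u v h), h1.2.trans h2.2⟩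

theorem M_of_le {α β : Dgm n} (hα : α ∈ Mset n) (h : ∀ x y, β.r x y → α.r x y) : β ∈ Mset n :=
  ⟨fun x y z h1 h2 => hα.1 x y z (h _ _ h1) (h _ _ h2),
   fun a b c d h1 h2 => hα.2 a b c d (h _ _ h1) (h _ _ h2)⟩

/-- hooked upper points -/
def hooked (α : Dgm n) : Finset (Fin n) :=
  Finset.univ.filter (fun u => ∃ v, v ≠ u ∧ α.r (Sum.inl u) (Sum.inl v))

theorem mem_hooked (α : Dgm n) (u : Fin n) :
    u ∈ hooked α ↔ ∃ v, v ≠ u ∧ α.r (Sum.inl u) (Sum.inl v) := by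
  simp [hooked]

theorem elim_hooks (N : ℕ) : ∀ α : Dgm n, α ∈ Mset n → (hooked α).card = N →
    (∀ β ∈ Mset n, NoUp β → domSet β = domSet α → LowEq β α → β ∈ RR n) → α ∈ RR n := by
  induction N using Nat.strong_induction_on with
  | _ N ih =>
  intro α hα hN H
  by_cases hu : NoUp α
  · exact H α hα hu rfl ⟨fun _ _ h => h, rfl⟩
  have ex : ∃ d : ℕ, ∃ u v : Fin n, (v : ℕ) = u + d + 1 ∧ α.r (Sum.inl u) (Sum.inl v) := by
    unfold NoUp at hu
    push Not at hu
    obtain ⟨u, v, h1, h2⟩ := hu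
    rcases lt_or_gt_of_ne h2 with h3 | h3
    · exact ⟨v - u - 1, u, v, by rw [Fin.lt_def] at h3; omega, h1⟩
    · exact ⟨u - v - 1, v, u, by rw [Fin.lt_def] at h3; omega, ssymm α _ _ h1⟩
  have hmin := fun m => @Nat.find_min _ _ ex m
  obtain ⟨u, v, huv, hr⟩ := Nat.find_spec ex
  generalize Nat.find ex = d at hmin huv
  have huv' : u < v := by rw [Fin.lt_def]; omega
  have pu : ∀ y, α.r (Sum.inl u) y → y = Sum.inl u ∨ y = Sum.inl v := by
    intro y hy
    have := hα.1 _ _ _ hr hy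
    have n1 : (Sum.inl u : PBV n) ≠ Sum.inl v := inl_ne (by omega)
    grind
  have pv : ∀ y, α.r (Sum.inl v) y → y = Sum.inl u ∨ y = Sum.inl v := by
    intro y hy
    exact pu y (strans α _ _ _ hr hy)
  have hs : ∀ w, u < w → w < v → Sing α (Sum.inl w) := by
    intro w h1 h2 y hy
    rcases y with y | y
    · by_contra hne
      have hyw : (y : ℕ) ≠ w := fun e => hne (congrArg _ (Fin.ext e))
      have hyu : (y : ℕ) ≠ u := by
        intro e
        have e := Fin.ext e
        subst e
        rcases pu _ (ssymm α _ _ hy) with h | h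
        · exact h1.ne' (Sum.inl.inj h)
        · exact h2.ne (Sum.inl.inj h)
      have hyv : (y : ℕ) ≠ v := by
        intro e
        have e := Fin.ext e
        subst e
        rcases pv _ (ssymm α _ _ hy) with h | h
        · exact h1.ne' (Sum.inl.inj h)
        · exact h2.ne (Sum.inl.inj h)
      rw [Fin.lt_def] at h1 h2
      by_cases c1 : (y : ℕ) < u
      · exact hα.2 (Sum.inl y) (Sum.inl w) (Sum.inl u) (Sum.inl v) (ssymm α _ _ hy) hr c1 h1 h2
      by_cases c2 : (v : ℕ) < y
      · exact hα.2 (Sum.inl u) (Sum.inl v) (Sum.inl w) (Sum.inl y) hr hy h1 h2 c2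
      by_cases c3 : (w : ℕ) < y
      · exact hmin (y - w - 1) (by omega) ⟨w, y, by omega, hy⟩
      · exact hmin (w - y - 1) (by omega) ⟨y, w, by omega, ssymm α _ _ hy⟩
    · exact (hook_not_dom hα hr huv' h1.le h2.le ⟨y, hy⟩).elim
  refine hookR d α u v huv hr pu hs ?_
  have le : ∀ x y, (op1 (Sum.inl v) α).r x y → α.r x y := by
    intro x y h
    rw [op1_r] at h
    rcases h with rfl | h
    · exact srefl α _
    · exact h.2.2
  have hvd : v ∉ domSet α := hook_not_dom hα hr huv' huv'.le le_rfl
  have hlow : LowEq (op1 (Sum.inl v) α) α := by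
    refine ⟨fun _ _ h => le _ _ h, ?_⟩
    ext a
    constructor
    · rintro ⟨b, hb⟩; exact ⟨b, le _ _ hb⟩
    · rintro ⟨b, hb⟩
      refine ⟨b, ?_⟩
      rw [op1_r]
      refine Or.inr ⟨by simp, ?_, hb⟩
      intro e
      have e := Sum.inl.inj e
      subst e
      exact hvd ⟨a, ssymm α _ _ hb⟩
  have hdom : domSet (op1 (Sum.inl v) α) = domSet α := by
    ext a
    constructor
    · rintro ⟨b, hb⟩; exact ⟨b, le _ _ hb⟩
    · rintro ⟨b, hb⟩
      refine ⟨b, ?_⟩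
      rw [op1_r]
      refine Or.inr ⟨?_, by simp, hb⟩
      intro e
      have e := Sum.inl.inj e
      subst e
      exact hvd ⟨b, hb⟩
  refine ih _ ?_ _ (M_of_le hα le) rfl ?_
  · rw [← hN]
    apply Finset.card_lt_card
    rw [Finset.ssubset_iff_of_subset]
    · refine ⟨v, ?_, ?_⟩
      · rw [mem_hooked]; exact ⟨u, huv'.ne, ssymm α _ _ hr⟩
      · rw [mem_hooked]
        rintro ⟨w, h1, h2⟩
        rw [op1_r] at h2
        rcases h2 with h2 | h2
        · exact h1 (Sum.inl.inj h2).symm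
        · exact h2.1 rfl
    · intro w hw
      rw [mem_hooked] at hw ⊢
      obtain ⟨z, h1, h2⟩ := hw
      exact ⟨z, h1, le _ _ h2⟩
  · intro β h1 h2 h3 h4
    exact H β h1 h2 (h3.trans hdom) (h4.trans hlow)

theorem comap_M {α : Dgm n} (hα : α ∈ Mset n) (f : Equiv.Perm (PBV n))
    (h : ∀ x y, ¬ Sing α (f x) → ¬ Sing α (f y) → vpos x < vpos y → vpos (f x) < vpos (f y)) :
    Setoid.comap f α ∈ Mset n := by
  constructor
  · intro x y z h1 h2
    have := hα.1 _ _ _ h1 h2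
    simpa only [f.injective.eq_iff] using this
  · intro a b c d h1 h2 h3 h4 h5
    have h1' : α.r (f a) (f b) := h1
    have h2' : α.r (f c) (f d) := h2
    have ns : ∀ x y, vpos x ≠ vpos y → α.r (f x) (f y) → ¬ Sing α (f x) := by
      intro x y hne hr hs
      exact hne (congrArg _ (f.injective (hs _ hr).symm))
    have na := ns a b (by omega) h1'
    have nb := ns b a (by omega) (ssymm α _ _ h1')
    have nc := ns c d (by omega) h2'
    have nd := ns d c (by omega) (ssymm α _ _ h2')
    exact hα.2 _ _ _ _ h1' h2' (h _ _ na nc h3) (h _ _ nc nb h4) (h _ _ nb nd h5)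

theorem sing_of_noup {α : Dgm n} (hu : NoUp α) {w : Fin n} (hw : w ∉ domSet α) :
    Sing α (Sum.inl w) := by
  rintro (y | y) hy
  · rw [hu _ _ hy]
  · exact (hw ⟨y, hy⟩).elim

theorem sw_inr (p q : Fin n) (x : Fin n) : sw p q (Sum.inr x) = Sum.inr x :=
  sw_other _ _ _ (by simp) (by simp)

theorem sw_inl (p q : Fin n) (x : Fin n) : sw p q (Sum.inl x) = Sum.inl (gsw p q x) := by
  by_cases h1 : x = p
  · subst h1; rw [sw_left, gsw_left]
  by_cases h2 : x = q
  · subst h2; rw [sw_right, gsw_right]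
  rw [sw_other, gsw_other _ _ _ h1 h2]
  · simpa using h1
  · simpa using h2

theorem gsw_gsw {V : Type*} (p q x : V) : gsw p q (gsw p q x) = x := by simp [gsw]

theorem move {α : Dgm n} (hα : α ∈ Mset n) (hu : NoUp α) (p q : Fin n) (hpq : p < q)
    (hd : ∀ w, p ≤ w → w < q → w ∉ domSet α) :
    Setoid.comap (sw p q) α ∈ Mset n ∧ NoUp (Setoid.comap (sw p q) α) ∧
    LowEq (Setoid.comap (sw p q) α) α ∧
    ∀ w, w ∈ domSet (Setoid.comap (sw p q) α) ↔ gsw p q w ∈ domSet α := by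
  refine ⟨?_, ?_, ⟨?_, ?_⟩, ?_⟩
  · apply comap_M hα
    have hp := hpq
    rw [Fin.lt_def] at hp
    have key : ∀ x : PBV n, ¬ Sing α (sw p q x) → (vpos x = p ∧ vpos (sw p q x) = q) ∨
        (vpos (sw p q x) = vpos x ∧ (vpos x < p ∨ q < vpos x)) := by
      rintro (x | x) hx
      · by_cases h1 : x = p
        · subst h1; left; rw [sw_left]; exact ⟨rfl, rfl⟩
        by_cases h2 : x = q
        · subst h2
          rw [sw_right] at hx
          exact (hx (sing_of_noup hu (hd _ le_rfl hpq))).elim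
        have e : sw p q (Sum.inl x) = Sum.inl x := by
          rw [sw_inl, gsw_other _ _ _ h1 h2]
        rw [e] at hx ⊢
        right
        refine ⟨rfl, ?_⟩
        by_contra hc
        simp only [vpos] at hc
        have h2' : (x : ℕ) ≠ q := fun e => h2 (Fin.ext e)
        exact hx (sing_of_noup hu (hd x (by rw [Fin.le_def]; omega) (by rw [Fin.lt_def]; omega)))
      · right
        rw [sw_inr]
        refine ⟨rfl, Or.inr ?_⟩
        simp only [vpos]; omega
    intro x y hx hy hxy
    have kx := key x hx
    have ky := key y hy
    omega
  · intro u v h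
    rw [comap_r (sw p q) α, sw_inl, sw_inl] at h
    exact (gsw p q).injective (hu _ _ h)
  · intro u v h
    rw [comap_r (sw p q) α, sw_inr, sw_inr] at h
    exact h
  · ext a
    constructor
    · rintro ⟨b, hb⟩
      rw [comap_r (sw p q) α, sw_inr, sw_inl] at hb
      exact ⟨_, hb⟩
    · rintro ⟨b, hb⟩
      refine ⟨gsw p q b, ?_⟩
      rw [comap_r (sw p q) α, sw_inr, sw_inl, gsw_gsw]
      exact hb
  · intro w
    constructor
    · rintro ⟨b, hb⟩
      rw [comap_r (sw p q) α, sw_inr, sw_inl] at hb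
      exact ⟨_, hb⟩
    · rintro ⟨b, hb⟩
      refine ⟨b, ?_⟩
      rw [comap_r (sw p q) α, sw_inr, sw_inl]
      exact hb

theorem pair_stage (d : ℕ) : ∀ (α : Dgm n) (j k : Fin n), α ∈ Mset n → NoUp α → (k : ℕ) = j + 1 →
    (k : ℕ) + d + 1 = n → j ∉ domSet α → k ∉ domSet α →
    (∀ β ∈ Mset n, NoUp β → LowEq β α → (∀ w : Fin n, n ≤ (w : ℕ) + 2 → w ∉ domSet β) → β ∈ RR n) →
    α ∈ RR n := by
  induction d with
  | zero =>
    intro α j k hα hu hk hn hj hk' H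
    refine H α hα hu ⟨fun _ _ h => h, rfl⟩ ?_
    intro w hw
    have := w.2
    rcases (by omega : (w : ℕ) = j ∨ (w : ℕ) = k) with h | h
    · rwa [Fin.ext h]
    · rwa [Fin.ext h]
  | succ d ih =>
    intro α j k hα hu hk hn hj hk' H
    obtain ⟨q, hq⟩ : ∃ q : Fin n, (q : ℕ) = k + 1 := ⟨⟨k + 1, by omega⟩, rfl⟩
    have hjq : j < q := by rw [Fin.lt_def]; omega
    obtain ⟨m1, m2, m3, m4⟩ := move hα hu j q hjq (by
      intro w h1 h2
      rw [Fin.le_def] at h1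
      rw [Fin.lt_def] at h2
      rcases (by omega : (w : ℕ) = j ∨ (w : ℕ) = k) with h | h
      · rwa [Fin.ext h]
      · rwa [Fin.ext h])
    have sj := sing_of_noup hu hj
    have sk := sing_of_noup hu hk'
    refine S2R α q k j (by omega) sk sj ?_
    rw [sw_comm]
    refine ih _ k q m1 m2 hq (by omega) ?_ ?_ ?_
    · rw [m4, gsw_other]
      · exact hk'
      · intro e; rw [e] at hk; omega
      · intro e; rw [e] at hq; omega
    · rw [m4, gsw_right]; exact hj
    · intro β h1 h2 h3 h4
      exact H β h1 h2 (h3.trans m3) h4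

/-- downward closed sets -/
def DownC (A : Set (Fin n)) : Prop := ∀ u v : Fin n, u ≤ v → v ∈ A → u ∈ A

theorem downC_of_step {A : Set (Fin n)} (h : ∀ u v : Fin n, (v : ℕ) = u + 1 → v ∈ A → u ∈ A) :
    DownC A := by
  have key : ∀ d : ℕ, ∀ u v : Fin n, (v : ℕ) = u + d → v ∈ A → u ∈ A := by
    intro d
    induction d with
    | zero => intro u v e hv; rwa [← Fin.ext (e.trans (Nat.add_zero _))]
    | succ d ih =>
      intro u v e hv
      have := v.2
      exact ih u ⟨u + d, by omega⟩ rfl (h _ v (by simp; omega) hv)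
  intro u v huv hv
  rw [Fin.le_def] at huv
  exact key (v - u) u v (by omega) hv

/-- termination measure -/
def dsum (α : Dgm n) : ℕ := ∑ i : Fin n, if i ∈ domSet α then (i : ℕ) else 0

theorem init_stage (N : ℕ) : ∀ (α : Dgm n), dsum α = N → α ∈ Mset n → NoUp α →
    (∀ w : Fin n, n ≤ (w : ℕ) + 2 → w ∉ domSet α) →
    (∀ β ∈ Mset n, NoUp β → LowEq β α → DownC (domSet β) → β ∈ RR n) → α ∈ RR n := by
  induction N using Nat.strong_induction_on with
  | _ N ih =>
  intro α hN hα hu hw H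
  by_cases hd : ∀ u v : Fin n, (v : ℕ) = u + 1 → v ∈ domSet α → u ∈ domSet α
  · exact H α hα hu ⟨fun _ _ h => h, rfl⟩ (downC_of_step hd)
  push Not at hd
  obtain ⟨g, g', hg, hg', hgn⟩ := hd
  have hlt : g < g' := by rw [Fin.lt_def]; omega
  have hg2 : (g' : ℕ) + 2 < n := by
    by_contra hc
    exact hw g' (by omega) hg'
  obtain ⟨m1, m2, m3, m4⟩ := move hα hu g g' hlt (by
      intro w h1 h2
      rw [Fin.le_def] at h1
      rw [Fin.lt_def] at h2
      rwa [Fin.ext (by omega : (w : ℕ) = g)])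
  obtain ⟨j, hj⟩ : ∃ j : Fin n, (j : ℕ) + 2 = n := ⟨⟨n - 2, by omega⟩, by simp; omega⟩
  obtain ⟨j', hj'⟩ : ∃ j' : Fin n, (j' : ℕ) + 1 = n := ⟨⟨n - 1, by omega⟩, by simp; omega⟩
  refine carry (j - g - 2) α g g' j j' hg (by omega) (by omega) (sing_of_noup hu hgn)
    (sing_of_noup hu (hw j (by omega))) (sing_of_noup hu (hw j' (by omega))) ?_
  refine ih _ ?_ _ rfl m1 m2 ?_ ?_
  · rw [← hN]
    unfold dsum
    have e : (∑ i : Fin n, if i ∈ domSet (Setoid.comap (sw g g') α) then (i : ℕ) else 0) =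
        ∑ i : Fin n, if i ∈ domSet α then ((gsw g g' i : Fin n) : ℕ) else 0 := by
      rw [← Equiv.sum_comp (gsw g g')]
      apply Finset.sum_congr rfl
      intro i _
      rw [m4, gsw_gsw]
    rw [e]
    apply Finset.sum_lt_sum
    · intro i _
      split_ifs with hi
      · have : i ≠ g := fun e => hgn (e ▸ hi)
        by_cases h2 : i = g'
        · subst h2; rw [gsw_right]; omega
        · rw [gsw_other _ _ _ this h2]
      · exact le_rfl
    · refine ⟨g', Finset.mem_univ _, ?_⟩
      rw [if_pos hg', if_pos hg', gsw_right]; omega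
  · intro w hw'
    rw [m4, gsw_other]
    · exact hw w hw'
    · intro e; rw [e] at hw'; omega
    · intro e; rw [e] at hw'; omega
  · intro β h1 h2 h3 h4
    exact H β h1 h2 (h3.trans m3) h4

theorem lemmaU {α : Dgm n} (hα : α ∈ Mset n) (hc : ¬ CosparseS (domSet α))
    (H : ∀ β ∈ Mset n, NoUp β → LowEq β α → DownC (domSet β) → β ∈ RR n) : α ∈ RR n := by
  refine elim_hooks _ α hα rfl ?_
  intro β h1 h2 h3 h4
  rw [not_cosparse] at hc
  obtain ⟨i, j, hi, hj, hij⟩ := hc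
  rw [← h3] at hi hj
  refine pair_stage (n - 1 - j) β i j h1 h2 hij (by have := j.2; omega) hi hj ?_
  intro γ g1 g2 g3 g4
  refine init_stage _ γ rfl g1 g2 g4 ?_
  intro δ d1 d2 d3 d4
  exact H δ d1 d2 (d3.trans (g3.trans h4)) d4

theorem final_stage {α : Dgm n} (hα : α ∈ Mset n) (hu : NoUp α)
    (hl : ∀ u v : Fin n, α.r (Sum.inr u) (Sum.inr v) → u = v)
    (hd : DownC (domSet α)) (hc : DownC (codomSet α)) : α ∈ RR n := by
  rw [eq_idd hu hl ?_]
  · exact RR_idd _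
  have pb1 : ∀ u v w : Fin n, α.r (Sum.inl u) (Sum.inr v) → α.r (Sum.inl u) (Sum.inr w) → v = w := by
    intro u v w h1 h2
    simpa using hα.1 _ _ _ h1 h2
  have pb2 : ∀ u v w : Fin n, α.r (Sum.inl v) (Sum.inr u) → α.r (Sum.inl w) (Sum.inr u) → v = w := by
    intro u v w h1 h2
    simpa using hα.1 _ _ _ (ssymm α _ _ h1) (ssymm α _ _ h2)
  have key : ∀ N : ℕ, ∀ u v : Fin n, (u : ℕ) = N → α.r (Sum.inl u) (Sum.inr v) → u = v := by
    intro N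
    induction N using Nat.strong_induction_on with
    | _ N ih =>
    intro u v hN h
    rcases lt_trichotomy u v with h1 | h1 | h1
    · obtain ⟨t, ht⟩ := hc u v h1.le ⟨u, ssymm α _ _ h⟩
      have ht := ssymm α _ _ ht
      rcases lt_trichotomy u t with h2 | h2 | h2
      · exfalso
        refine hα.2 _ _ _ _ h ht h2 ?_ ?_
        · simp only [vpos]; omega
        · rw [Fin.lt_def] at h1
          simp only [vpos]; omega
      · subst h2
        exact pb1 _ _ _ ht h
      · have := ih t (by rw [Fin.lt_def] at h2; omega) t u rfl ht
        exact (h2.ne this).elim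
    · exact h1
    · obtain ⟨w, hw⟩ := hd v u h1.le ⟨v, h⟩
      have := ih v (by rw [Fin.lt_def] at h1; omega) v w rfl hw
      subst this
      exact pb2 _ _ _ h hw
  exact fun u v h => key u u v rfl h

theorem TT_RR {α : Dgm n} (h : α ∈ TT n) : α ∈ RR n := by
  rcases h with ⟨A, _, rfl⟩ | ⟨hα, h1, h2⟩
  · exact RR_idd A
  refine lemmaU hα h1 ?_
  intro β b1 b2 b3 b4
  rw [← pstar_pstar β]
  apply RR_star
  refine lemmaU (pstar_M b1) ?_ ?_
  · rw [dom_star, b3.2]; exact h2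
  · intro γ g1 g2 g3 g4
    refine final_stage g1 g2 ?_ g4 ?_
    · intro u v h
      exact b2 u v (g3.1 u v h)
    · rw [g3.2, codom_star]; exact b4

theorem gen_RR_sub {Y : Set (Dgm n)} (hY : Y ⊆ RR n) : genSet (pmul (n := n)) Y ⊆ RR n := by
  intro α h
  have h' : MClo (pmul (n := n)) Y α := h
  clear h
  induction h' with
  | base hx => exact hY hx
  | mul _ _ ih1 ih2 => exact RR_mul ih1 ih2

theorem RR_eq : RR n = TT n := Set.Subset.antisymm (fun _ h => gen_XX_TT h) (fun _ h => TT_RR h)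

theorem gen_mono {γ : Type*} (m : γ → γ → γ) {X Y : Set γ} (h : X ⊆ Y) : genSet m X ⊆ genSet m Y := by
  intro α h'
  have h'' : MClo m X α := h'
  clear h'
  induction h'' with
  | base hx => exact MClo.base (h hx)
  | mul _ _ ih1 ih2 => exact MClo.mul ih1 ih2

theorem first_eq : genSet (pmul (n := n)) {α | α ∈ Mset n ∧ IsIdpt α} = TT n := by
  apply Set.Subset.antisymm
  · rw [← RR_eq]
    apply gen_RR_sub
    rintro α ⟨h1, h2⟩
    exact TT_RR (idpt_TT h1 h2)
  · rw [← RR_eq]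
    exact gen_mono _ (fun α h => XX_idpt h)

end Dgm

namespace Dgm
variable {n : ℕ}

/-- pairs indexing the generators other than the identity -/
def gp (n : ℕ) : Fin n ⊕ (Fin (n - 1) ⊕ Fin (n - 2)) → Fin n × Fin n
  | Sum.inl a => (a, a)
  | Sum.inr (Sum.inl a) => (⟨a, by omega⟩, ⟨a + 1, by omega⟩)
  | Sum.inr (Sum.inr a) => (⟨a, by omega⟩, ⟨a + 2, by omega⟩)

theorem gp_inj : Function.Injective (gp n) := by
  rintro (a | a | a) (b | b | b) h <;> simp only [gp, Prod.mk.injEq, Fin.ext_iff] at h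
  · rw [Fin.ext h.1]
  · omega
  · omega
  · omega
  · rw [Fin.ext h.1]
  · omega
  · omega
  · omega
  · rw [Fin.ext h.1]

theorem gp_le (s : Fin n ⊕ (Fin (n - 1) ⊕ Fin (n - 2))) :
    (gp n s).1 ≤ (gp n s).2 ∧ ((gp n s).2 : ℕ) ≤ (gp n s).1 + 2 := by
  rcases s with (a | a | a) <;> simp [gp, Fin.le_def]

theorem gp_surj (i k : Fin n) (h1 : i ≤ k) (h2 : (k : ℕ) ≤ i + 2) : ∃ s, gp n s = (i, k) := by
  rw [Fin.le_def] at h1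
  have := k.2
  rcases (by omega : (k : ℕ) = i ∨ (k : ℕ) = i + 1 ∨ (k : ℕ) = i + 2) with h | h | h
  · refine ⟨Sum.inl i, ?_⟩
    simp [gp, Fin.ext_iff, h]
  · refine ⟨Sum.inr (Sum.inl ⟨i, by omega⟩), ?_⟩
    simp [gp, Fin.ext_iff, h]
  · refine ⟨Sum.inr (Sum.inr ⟨i, by omega⟩), ?_⟩
    simp [gp, Fin.ext_iff, h]

/-- index type for the generators -/
abbrev GI (n : ℕ) := Option (Fin n ⊕ (Fin (n - 1) ⊕ Fin (n - 2)))

theorem card_GI (h : 2 ≤ n) : Fintype.card (GI n) = 3 * n - 2 := by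
  simp [GI]; omega

/-- the generators, indexed -/
def gg (n : ℕ) : GI n → Dgm n
  | none => idd Set.univ
  | some s => eta (gp n s).1 (gp n s).2

theorem XX_range : XX n = Set.range (gg n) := by
  ext α
  constructor
  · rintro (rfl | ⟨i, k, h1, h2, rfl⟩)
    · exact ⟨none, rfl⟩
    · obtain ⟨s, hs⟩ := gp_surj i k h1 h2
      exact ⟨some s, by simp only [gg, hs]⟩
  · rintro ⟨(_ | s), rfl⟩
    · exact Or.inl rfl
    · exact Or.inr ⟨_, _, (gp_le s).1, (gp_le s).2, rfl⟩

/-- prime classes -/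
def Qik (i k : Fin n) : Set (Dgm n) :=
  {α | α.r (Sum.inl i) (Sum.inl k) ∧ ∀ u, u ∈ domSet α ↔ ¬ (i ≤ u ∧ u ≤ k)}

def QQ (n : ℕ) : GI n → Set (Dgm n)
  | none => {α | domSet α = Set.univ}
  | some s => Qik (gp n s).1 (gp n s).2

theorem eta_Q (i k : Fin n) (h : i ≤ k) : eta i k ∈ Qik i k := by
  refine ⟨?_, ?_⟩
  · rw [eta_r]; simp only [etaLab]; grind
  · intro u
    constructor
    · intro hu hc
      exact eta_dom i k u hc.1 hc.2 hu
    · intro hu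
      refine ⟨u, ?_⟩
      rw [eta_r]; simp only [etaLab]; rw [if_neg hu, if_neg hu]

theorem Q_prime (i k : Fin n) (hik : i ≤ k) (hk : (k : ℕ) ≤ i + 2) {x y : Dgm n} (hx : x ∈ TT n)
    (hy : y ∈ TT n) (h : pmul x y ∈ Qik i k) : x ∈ Qik i k ∨ y ∈ Qik i k := by
  obtain ⟨hr, hd⟩ := h
  have hsub : ∀ u, ¬ (i ≤ u ∧ u ≤ k) → u ∈ domSet x := fun u hu => dom_pmul x y ((hd u).2 hu)
  rcases hx with ⟨A, _, rfl⟩ | ⟨hM, hc, _⟩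
  · by_cases hc : i ∉ A ∨ k ∉ A
    · left
      have hl : (idd A).r (Sum.inl i) (Sum.inl k) := by
        rcases hc with hc | hc
        · exact not_dom_hook _ y _ _ (by rwa [idd_dom]) hr
        · exact ssymm _ _ _ (not_dom_hook _ y _ _ (by rwa [idd_dom]) (ssymm _ _ _ hr))
      have e : i = k := by
        rw [idd_r] at hl
        rcases hl with hl | ⟨a, _, hl | hl⟩
        · exact Sum.inl.inj hl
        · cases hl.2
        · cases hl.1
      refine ⟨hl, fun u => ⟨?_, hsub u⟩⟩
      subst e
      rw [idd_dom]
      rintro hu ⟨h1, h2⟩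
      have := le_antisymm h1 h2
      subst this
      tauto
    · right
      push Not at hc
      have hyr : y.r (Sum.inl i) (Sum.inl k) := idd_pmul_le _ _ _ _ hr
      refine ⟨hyr, fun u => ⟨?_, ?_⟩⟩
      · rintro hu ⟨h1, h2⟩
        rcases hik.eq_or_lt with e | hlt
        · subst e
          have := le_antisymm h1 h2
          subst this
          obtain ⟨j, hj⟩ := hu
          have h3 : (idd A).r (Sum.inl i) (Sum.inr i) := by
            rw [idd_r]; exact Or.inr ⟨i, hc.1, Or.inl ⟨rfl, rfl⟩⟩
          have h4 : (pmul (idd A) y).r (Sum.inl i) (Sum.inr j) := (edge_top h3).trans (edge_bot hj)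
          exact (hd i).1 ⟨j, h4⟩ ⟨le_rfl, le_rfl⟩
        · exact hook_not_dom (TT_M hy) hyr hlt h1 h2 hu
      · intro hu
        obtain ⟨j, hj⟩ := (hd u).2 hu
        exact ⟨j, idd_pmul_le _ _ _ _ hj⟩
  · left
    rw [not_cosparse] at hc
    obtain ⟨a, b, ha, hb, hab⟩ := hc
    have ha' : i ≤ a ∧ a ≤ k := by by_contra hc; exact ha (hsub _ hc)
    have hb' : i ≤ b ∧ b ≤ k := by by_contra hc; exact hb (hsub _ hc)
    simp only [Fin.le_def] at ha' hb'
    have hl : x.r (Sum.inl i) (Sum.inl k) := by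
      rcases (by omega : (a : ℕ) = i ∨ (b : ℕ) = k) with e | e
      · have e := Fin.ext e
        subst e
        exact not_dom_hook _ y _ _ ha hr
      · have e := Fin.ext e
        subst e
        exact ssymm _ _ _ (not_dom_hook _ y _ _ hb (ssymm _ _ _ hr))
    refine ⟨hl, fun u => ⟨?_, hsub u⟩⟩
    rintro hu ⟨h1, h2⟩
    exact hook_not_dom hM hl (by rw [Fin.lt_def]; omega) h1 h2 hu

theorem QQ_prime (s : GI n) {x y : Dgm n} (hx : x ∈ TT n)
    (hy : y ∈ TT n) (h : pmul x y ∈ QQ n s) : x ∈ QQ n s ∨ y ∈ QQ n s := by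
  rcases s with _ | s
  · left
    exact Set.eq_univ_of_univ_subset ((Eq.ge h).trans (dom_pmul x y))
  · exact Q_prime _ _ (gp_le s).1 (gp_le s).2 hx hy h

theorem QQ_gg (s : GI n) : gg n s ∈ QQ n s := by
  rcases s with _ | s
  · exact idd_dom _
  · exact eta_Q _ _ (gp_le s).1

theorem gg_TT (s : GI n) : gg n s ∈ TT n := by
  rw [← RR_eq]
  refine MClo.base ?_
  rw [XX_range]
  exact ⟨s, rfl⟩

theorem QQ_disj (s t : GI n) (α : Dgm n) (hs : α ∈ QQ n s) (ht : α ∈ QQ n t) : s = t := by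
  rcases s with _ | s <;> rcases t with _ | t
  · rfl
  · exfalso
    have h1 : domSet α = Set.univ := hs
    have h2 := (ht.2 (gp n t).1).1 (by rw [h1]; trivial)
    exact h2 ⟨le_rfl, (gp_le t).1⟩
  · exfalso
    have h1 : domSet α = Set.univ := ht
    have h2 := (hs.2 (gp n s).1).1 (by rw [h1]; trivial)
    exact h2 ⟨le_rfl, (gp_le s).1⟩
  · have key : ∀ u, ((gp n s).1 ≤ u ∧ u ≤ (gp n s).2) ↔ ((gp n t).1 ≤ u ∧ u ≤ (gp n t).2) := by
      intro u
      exact not_iff_not.1 ((hs.2 u).symm.trans (ht.2 u))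
    have s1 := (gp_le s).1
    have t1 := (gp_le t).1
    have a := (key (gp n s).1).1 ⟨le_rfl, s1⟩
    have b := (key (gp n s).2).1 ⟨s1, le_rfl⟩
    have c := (key (gp n t).1).2 ⟨le_rfl, t1⟩
    have d := (key (gp n t).2).2 ⟨t1, le_rfl⟩
    have e : gp n s = gp n t := Prod.ext (le_antisymm c.1 a.1) (le_antisymm b.2 d.2)
    rw [gp_inj e]

theorem gen_meets {Y : Set (Dgm n)} (hY : genSet (pmul (n := n)) Y = TT n) (s : GI n) (α : Dgm n)
    (h : MClo (pmul (n := n)) Y α) (hα : α ∈ QQ n s) : ∃ y ∈ Y, y ∈ QQ n s := by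
  induction h with
  | base hx => exact ⟨_, hx, hα⟩
  | mul h1 h2 ih1 ih2 =>
    have t1 := hY.subset h1
    have t2 := hY.subset h2
    rcases QQ_prime s t1 t2 hα with h | h
    · exact ih1 h
    · exact ih2 h

theorem card_ge (hn : 2 ≤ n) (Y : Finset (Dgm n)) (hY : genSet (pmul (n := n)) ↑Y = TT n) :
    3 * n - 2 ≤ Y.card := by
  have h : ∀ s : GI n, ∃ y ∈ (Y : Set (Dgm n)), y ∈ QQ n s := fun s =>
    gen_meets hY s (gg n s) (hY.superset (gg_TT s)) (QQ_gg s)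
  choose f hf1 hf2 using h
  have inj : Function.Injective f := by
    intro s t e
    exact QQ_disj s t (f s) (hf2 s) (e ▸ hf2 t)
  rw [← card_GI hn, ← Finset.card_univ]
  exact Finset.card_le_card_of_injOn f (fun s _ => hf1 s) (inj.injOn)

/-- the generators as a finite set -/
def XF (n : ℕ) : Finset (Dgm n) := Finset.univ.image (gg n)

theorem XF_coe : (XF n : Set (Dgm n)) = XX n := by
  rw [XX_range, XF, Finset.coe_image, Finset.coe_univ, Set.image_univ]

theorem XF_gen : genSet (pmul (n := n)) ↑(XF n) = TT n := by
  rw [XF_coe, ← RR_eq]; rfl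

theorem XF_card (hn : 2 ≤ n) : (XF n).card = 3 * n - 2 := by
  apply le_antisymm
  · rw [← card_GI hn, ← Finset.card_univ]
    exact Finset.card_image_le
  · exact card_ge hn _ XF_gen

theorem XF_idpt : ∀ x ∈ XF n, pmul x x = x := by
  intro x hx
  have : x ∈ XX n := by rw [← XF_coe]; exact hx
  exact (XX_idpt this).2

end Dgm

theorem idempotent_generated_M (n : ℕ) (h : 2 ≤ n) :
    genSet (pmul (n := n)) {α | α ∈ Mset n ∧ IsIdpt α} =
      {α | ∃ A : Set (Fin n), CosparseS A ∧ α = idd A} ∪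
        {α | α ∈ Mset n ∧ ¬ CosparseS (domSet α) ∧ ¬ CosparseS (codomSet α)} ∧
    rnk (pmul (n := n)) (genSet (pmul (n := n)) {α | α ∈ Mset n ∧ IsIdpt α}) = 3 * n - 2 ∧
    idrnk (pmul (n := n)) (genSet (pmul (n := n)) {α | α ∈ Mset n ∧ IsIdpt α}) = 3 * n - 2 := by
  refine ⟨first_eq, ?_, ?_⟩
  · rw [first_eq]
    apply le_antisymm
    · exact Nat.sInf_le ⟨XF n, XF_card h, XF_gen⟩
    · refine le_csInf ⟨_, XF n, XF_card h, XF_gen⟩ ?_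
      rintro k ⟨Y, rfl, hY⟩
      exact card_ge h Y hY
  · rw [first_eq]
    apply le_antisymm
    · exact Nat.sInf_le ⟨XF n, XF_card h, XF_idpt, XF_gen⟩
    · refine le_csInf ⟨_, XF n, XF_card h, XF_idpt, XF_gen⟩ ?_
      rintro k ⟨Y, rfl, _, hY⟩
      exact card_ge h Y hY
end
end
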